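/- Let n ≥ 1. No Σₙ-definable extension of Robinson arithmetic Q that is consistent together with the set Π_{n−1}-Th(ℕ) of all true Π_{n−1}-sentences is Πₙ-deciding: if T ⊇ Q has its set of (Gödel numbers of) axioms definable in ℕ by a Σₙ-formula and T + Π_{n−1}-Th(ℕ) is consistent, then there exists a Πₙ-sentence γ with T ⊬ γ and T ⊬ ¬γ. -/

import Mathlib

/-!
Formalization of results from "Gödel–Rosser's Incompleteness Theorems for
non-RE Theories" (Salehi & Seraji).

We work in the first-order language of arithmetic `{0, S, +, ×, ≤}` with the
standard model `ℕ`.  Provability `T ⊢ φ` is rendered as the semantic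
consequence `T ⊨ᵇ φ` of Mathlib's model theory library, which by the Gödel
completeness theorem coincides with provability in first-order logic.
-/

open FirstOrder Language BoundedFormula

namespace GRNonRE

/-- Function symbols of arithmetic: `0`, `S`, `+`, `×`. -/
inductive ArithFunc : ℕ → Type
  | zero : ArithFunc 0
  | succ : ArithFunc 1
  | add  : ArithFunc 2
  | mul  : ArithFunc 2

/-- The relation symbol `≤`. -/
inductive ArithRel : ℕ → Type
  | le : ArithRel 2

/-- The first-order language of arithmetic `{0, S, +, ×, ≤}`. -/
def LA : FirstOrder.Language := ⟨ArithFunc, ArithRel⟩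

/-- The standard model `ℕ`. -/
instance : LA.Structure ℕ where
  funMap {_} f := match f with
    | ArithFunc.zero => fun _ => 0
    | ArithFunc.succ => fun v => v 0 + 1
    | ArithFunc.add  => fun v => v 0 + v 1
    | ArithFunc.mul  => fun v => v 0 * v 1
  RelMap {_} r := match r with
    | ArithRel.le => fun v => v 0 ≤ v 1

def zeroT {α : Type} : LA.Term α := Term.func ArithFunc.zero ![]
def succT {α : Type} (t : LA.Term α) : LA.Term α := Term.func ArithFunc.succ ![t]
def addT {α : Type} (t s : LA.Term α) : LA.Term α := Term.func ArithFunc.add ![t, s]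
def mulT {α : Type} (t s : LA.Term α) : LA.Term α := Term.func ArithFunc.mul ![t, s]

/-- The atomic formula `t ≤ s`. -/
def leF {α : Type} {n : ℕ} (t s : LA.Term (α ⊕ Fin n)) : LA.BoundedFormula α n :=
  BoundedFormula.rel ArithRel.le ![t, s]

/-- The numeral `m̄ = S (S ⋯ (S 0))` representing `m : ℕ`. -/
def numeral : ℕ → LA.Term Empty
  | 0 => zeroT
  | n + 1 => succT (numeral n)

instance : Encodable (Σ n, LA.Functions n) :=
  ⟨fun f => match f with
    | ⟨_, ArithFunc.zero⟩ => 0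
    | ⟨_, ArithFunc.succ⟩ => 1
    | ⟨_, ArithFunc.add⟩ => 2
    | ⟨_, ArithFunc.mul⟩ => 3,
   fun n => match n with
    | 0 => some ⟨0, ArithFunc.zero⟩
    | 1 => some ⟨1, ArithFunc.succ⟩
    | 2 => some ⟨2, ArithFunc.add⟩
    | 3 => some ⟨2, ArithFunc.mul⟩
    | _ => none,
   by rintro ⟨n, f⟩; cases f <;> rfl⟩

instance : Encodable (Σ n, LA.Relations n) :=
  ⟨fun _ => 0,
   fun n => match n with
    | 0 => some ⟨2, ArithRel.le⟩
    | _ => none,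
   by rintro ⟨n, r⟩; cases r; rfl⟩

/-- A standard Gödel numbering of formulas, obtained from Mathlib's structural
encoding of bounded formulas as lists of symbols. -/
def godel {k : ℕ} (φ : LA.BoundedFormula Empty k) : ℕ :=
  Encodable.encode φ.listEncode

/-- Lift a term in context `k` to context `k + 1`. -/
def liftT {k : ℕ} (t : LA.Term (Empty ⊕ Fin k)) : LA.Term (Empty ⊕ Fin (k + 1)) :=
  t.relabel (Sum.map id Fin.castSucc)

/-- The class `Σ₀ = Π₀ = Δ₀` of bounded formulas: built from atomic formulas by
Boolean connectives (`⊥` and `⟹`, from which `∼`, `⊓`, `⊔` are definable) and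
bounded universal quantification `∀ x ≤ t, φ` (bounded existential
quantification `∃ x ≤ t, φ` is expressible as `∼ ∀ x ≤ t, ∼φ`). -/
inductive Delta0 : ∀ {k : ℕ}, LA.BoundedFormula Empty k → Prop
  | falsum {k : ℕ} : Delta0 (⊥ : LA.BoundedFormula Empty k)
  | equal {k : ℕ} (t₁ t₂ : LA.Term (Empty ⊕ Fin k)) : Delta0 (t₁ =' t₂)
  | le {k : ℕ} (t₁ t₂ : LA.Term (Empty ⊕ Fin k)) : Delta0 (leF t₁ t₂)
  | imp {k : ℕ} {φ ψ : LA.BoundedFormula Empty k} :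
      Delta0 φ → Delta0 ψ → Delta0 (φ ⟹ ψ)
  | bdall {k : ℕ} (t : LA.Term (Empty ⊕ Fin k)) {φ : LA.BoundedFormula Empty (k + 1)} :
      Delta0 φ → Delta0 ((leF (&(Fin.last k)) (liftT t) ⟹ φ).all)

mutual
  /-- The classes `Σₙ` of the arithmetical hierarchy: `Σ₀` is the class of
  bounded formulas, and `Σ_{n+1}` contains `Πₙ` and is closed under `⊓`, `⊔`,
  existential quantification and bounded universal quantification. -/
  inductive IsSigma : ℕ → ∀ {k : ℕ}, LA.BoundedFormula Empty k → Prop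
    | ofDelta0 {k : ℕ} {φ : LA.BoundedFormula Empty k} : Delta0 φ → IsSigma 0 φ
    | ofPi {n k : ℕ} {φ : LA.BoundedFormula Empty k} :
        IsPi n φ → IsSigma (n + 1) φ
    | ex {n k : ℕ} {φ : LA.BoundedFormula Empty (k + 1)} :
        IsSigma (n + 1) φ → IsSigma (n + 1) φ.ex
    | inf {n k : ℕ} {φ ψ : LA.BoundedFormula Empty k} :
        IsSigma (n + 1) φ → IsSigma (n + 1) ψ → IsSigma (n + 1) (φ ⊓ ψ)
    | sup {n k : ℕ} {φ ψ : LA.BoundedFormula Empty k} :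
        IsSigma (n + 1) φ → IsSigma (n + 1) ψ → IsSigma (n + 1) (φ ⊔ ψ)
    | bdall {n k : ℕ} (t : LA.Term (Empty ⊕ Fin k))
        {φ : LA.BoundedFormula Empty (k + 1)} :
        IsSigma (n + 1) φ → IsSigma (n + 1) ((leF (&(Fin.last k)) (liftT t) ⟹ φ).all)

  /-- The classes `Πₙ` of the arithmetical hierarchy: `Π₀` is the class of
  bounded formulas, and `Π_{n+1}` contains `Σₙ` and is closed under `⊓`, `⊔`,
  universal quantification and bounded existential quantification. -/
  inductive IsPi : ℕ → ∀ {k : ℕ}, LA.BoundedFormula Empty k → Prop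
    | ofDelta0 {k : ℕ} {φ : LA.BoundedFormula Empty k} : Delta0 φ → IsPi 0 φ
    | ofSigma {n k : ℕ} {φ : LA.BoundedFormula Empty k} :
        IsSigma n φ → IsPi (n + 1) φ
    | all {n k : ℕ} {φ : LA.BoundedFormula Empty (k + 1)} :
        IsPi (n + 1) φ → IsPi (n + 1) φ.all
    | inf {n k : ℕ} {φ ψ : LA.BoundedFormula Empty k} :
        IsPi (n + 1) φ → IsPi (n + 1) ψ → IsPi (n + 1) (φ ⊓ ψ)
    | sup {n k : ℕ} {φ ψ : LA.BoundedFormula Empty k} :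
        IsPi (n + 1) φ → IsPi (n + 1) ψ → IsPi (n + 1) (φ ⊔ ψ)
    | bdex {n k : ℕ} (t : LA.Term (Empty ⊕ Fin k))
        {φ : LA.BoundedFormula Empty (k + 1)} :
        IsPi (n + 1) φ → IsPi (n + 1) ((leF (&(Fin.last k)) (liftT t) ⊓ φ).ex)
end

/-- `T ⊢ φ`: by the Gödel completeness theorem, provability of the sentence `φ`
from the theory `T` coincides with the semantic consequence relation. -/
def Proves (T : LA.Theory) (φ : LA.Sentence) : Prop := T ⊨ᵇ φ

/-- Consistency of a theory. -/
def Consistent (T : LA.Theory) : Prop := ¬ Proves T ⊥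

/-- `ψ(m̄)`: the result of substituting the numeral `m̄` for the free variable
of a formula `ψ(x)` with one free variable. -/
def subst1 (ψ : LA.BoundedFormula Empty 1) (m : ℕ) : LA.Sentence :=
  ψ.toFormula.subst fun _ => numeral m

/-- `n`-consistency: there is no formula `ψ(x) ∈ Π_{n-1}` such that `T ⊢ ¬ψ(m̄)`
for every numeral `m̄` (`m ∈ ℕ`) and yet `T ⊢ ∃x ψ(x)`.
(`0`-consistency is ordinary consistency.) -/
def NCon : ℕ → LA.Theory → Prop
  | 0, T => Consistent T
  | n + 1, T => ¬ ∃ ψ : LA.BoundedFormula Empty 1, IsPi n ψ ∧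
      (∀ m : ℕ, Proves T (∼(subst1 ψ m))) ∧ Proves T ψ.ex

/-- The axioms of Robinson arithmetic `Q`:
`Sx ≠ 0`, `Sx = Sy → x = y`, `x ≠ 0 → ∃y x = Sy`, `x + 0 = x`,
`x + Sy = S(x + y)`, `x·0 = 0`, `x·Sy = x·y + x`, `x ≤ y ↔ ∃z z + x = y`. -/
def QTheory : LA.Theory :=
  { ∀' ∼(succT (&0) =' zeroT),
    ∀' ∀' ((succT (&0) =' succT (&1)) ⟹ (&0 =' &1)),
    ∀' (∼(&0 =' zeroT) ⟹ ∃' (&0 =' succT (&1))),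
    ∀' (addT (&0) zeroT =' &0),
    ∀' ∀' (addT (&0) (succT (&1)) =' succT (addT (&0) (&1))),
    ∀' (mulT (&0) zeroT =' zeroT),
    ∀' ∀' (mulT (&0) (succT (&1)) =' addT (mulT (&0) (&1)) (&0)),
    ((leF (&0) (&1) ⇔ ∃' (addT (&2) (&0) =' (&1)) : LA.BoundedFormula Empty 2)).alls }

/-- `T` is an extension of Robinson arithmetic `Q` (i.e. `T` proves `Q`). -/
def ExtendsQ (T : LA.Theory) : Prop := ∀ φ ∈ QTheory, Proves T φ

/-- `Πₙ-Th(ℕ)`: the set of `Πₙ`-sentences true in the standard model. -/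
def PiTh (n : ℕ) : LA.Theory := {φ | IsPi n φ ∧ ℕ ⊨ φ}

/-- Soundness: every theorem of `T` is true in `ℕ`. -/
def Sound (T : LA.Theory) : Prop := ∀ φ : LA.Sentence, Proves T φ → ℕ ⊨ φ

/-- `Σₙ`-soundness: every `Σₙ`-sentence provable in `T` is true in `ℕ`. -/
def SigmaSound (n : ℕ) (T : LA.Theory) : Prop :=
  ∀ φ : LA.Sentence, IsSigma n φ → Proves T φ → ℕ ⊨ φ

/-- A formula `Ψ(x)` with one free variable defines the set `A ⊆ ℕ` in `ℕ`. -/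
def Defines (Ψ : LA.BoundedFormula Empty 1) (A : Set ℕ) : Prop :=
  ∀ m : ℕ, m ∈ A ↔ Ψ.Realize (fun e => Empty.elim e) ![m]

/-- `A ⊆ ℕ` is definable in `ℕ` by a `Σₙ`-formula. -/
def SigmaDefinable (n : ℕ) (A : Set ℕ) : Prop := ∃ Ψ, IsSigma n Ψ ∧ Defines Ψ A

/-- `A ⊆ ℕ` is definable in `ℕ` by a `Πₙ`-formula. -/
def PiDefinable (n : ℕ) (A : Set ℕ) : Prop := ∃ Ψ, IsPi n Ψ ∧ Defines Ψ A

/-- The set of Gödel numbers of the axioms of `T`. -/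
def axiomCodes (T : LA.Theory) : Set ℕ := {m | ∃ φ ∈ T, godel φ = m}

/-- The set of Gödel numbers of the theorems of `T` (its deductive closure). -/
def theoremCodes (T : LA.Theory) : Set ℕ := {m | ∃ φ, Proves T φ ∧ godel φ = m}

/-! ### Satisfaction and substitution -/

/-- Satisfaction of a formula without free variables outside of its context. -/
abbrev Sat {M : Type} [LA.Structure M] {k : ℕ} (φ : LA.BoundedFormula Empty k) (v : Fin k → M) :
    Prop :=
  φ.Realize (default : Empty → M) v

/-- The value of a term in context `k`. -/
abbrev val {M : Type} [LA.Structure M] {k : ℕ} (v : Fin k → M) (t : LA.Term (Empty ⊕ Fin k)) : M :=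
  t.realize (Sum.elim (default : Empty → M) v)

/-- The interpretation of `≤`. -/
def Le {M : Type} [LA.Structure M] (a b : M) : Prop :=
  Structure.RelMap (L := LA) (M := M) ArithRel.le ![a, b]

section Semantics

variable {M : Type} [LA.Structure M] {k k' : ℕ}

theorem sat_leF (t s : LA.Term (Empty ⊕ Fin k)) (v : Fin k → M) :
    Sat (leF t s) v ↔ Le (val v t) (val v s) := by
  change Structure.RelMap (L := LA) ArithRel.le (fun i => val v (![t, s] i)) ↔ Le _ _
  refine iff_of_eq (congrArg _ (funext fun i => ?_))
  fin_cases i <;> rfl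

theorem sat_equal (t s : LA.Term (Empty ⊕ Fin k)) (v : Fin k → M) :
    Sat (t =' s) v ↔ val v t = val v s := Iff.rfl

theorem val_liftT (t : LA.Term (Empty ⊕ Fin k)) (v : Fin k → M) (a : M) :
    val (Fin.snoc v a : Fin (k + 1) → M) (liftT t) = val v t := by
  unfold val liftT
  rw [Term.realize_relabel]
  congr 1
  funext i
  rcases i with i | i
  · exact i.elim
  · simp

theorem val_last (v : Fin k → M) (a : M) :
    val (Fin.snoc v a : Fin (k + 1) → M) (&(Fin.last k)) = a := by
  simp [val]

theorem sat_bdall (t : LA.Term (Empty ⊕ Fin k)) (φ : LA.BoundedFormula Empty (k + 1))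
    (v : Fin k → M) : Sat ((leF (&(Fin.last k)) (liftT t) ⟹ φ).all) v ↔
      ∀ a : M, Le a (val v t) → Sat φ (Fin.snoc v a) := by
  unfold Sat
  rw [realize_all]
  refine forall_congr' fun a => ?_
  rw [realize_imp]
  have := sat_leF (&(Fin.last k)) (liftT t) (Fin.snoc v a : Fin (k + 1) → M)
  rw [val_liftT, val_last] at this
  rw [← this]

theorem sat_bdex (t : LA.Term (Empty ⊕ Fin k)) (φ : LA.BoundedFormula Empty (k + 1))
    (v : Fin k → M) : Sat ((leF (&(Fin.last k)) (liftT t) ⊓ φ).ex) v ↔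
      ∃ a : M, Le a (val v t) ∧ Sat φ (Fin.snoc v a) := by
  unfold Sat
  rw [realize_ex]
  refine exists_congr fun a => ?_
  rw [realize_inf]
  have := sat_leF (&(Fin.last k)) (liftT t) (Fin.snoc v a : Fin (k + 1) → M)
  rw [val_liftT, val_last] at this
  rw [← this]

end Semantics

/-- Substitution of terms for the context variables of a term. -/
def tsub {k k' : ℕ} (t : LA.Term (Empty ⊕ Fin k)) (σ : Fin k → LA.Term (Empty ⊕ Fin k')) :
    LA.Term (Empty ⊕ Fin k') :=
  t.subst (Sum.elim (fun e => e.elim) σ)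

/-- Extension of a substitution under a quantifier. -/
def liftS {k k' : ℕ} (σ : Fin k → LA.Term (Empty ⊕ Fin k')) :
    Fin (k + 1) → LA.Term (Empty ⊕ Fin (k' + 1)) :=
  Fin.snoc (fun i => liftT (σ i)) (&(Fin.last k'))

/-- Substitution of terms for the context variables of a formula. -/
def bsub : ∀ {k k' : ℕ}, LA.BoundedFormula Empty k → (Fin k → LA.Term (Empty ⊕ Fin k')) →
    LA.BoundedFormula Empty k'
  | _, _, .falsum, _ => .falsum
  | _, _, .equal t s, σ => .equal (tsub t σ) (tsub s σ)
  | _, _, .rel R ts, σ => .rel R fun i => tsub (ts i) σ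
  | _, _, .imp φ ψ, σ => .imp (bsub φ σ) (bsub ψ σ)
  | _, _, .all φ, σ => .all (bsub φ (liftS σ))

theorem val_tsub {M : Type} [LA.Structure M] {k k' : ℕ} (t : LA.Term (Empty ⊕ Fin k))
    (σ : Fin k → LA.Term (Empty ⊕ Fin k')) (v : Fin k' → M) :
    val v (tsub t σ) = val (fun i => val v (σ i)) t := by
  unfold val tsub
  rw [Term.realize_subst]
  congr 1
  funext i
  rcases i with i | i
  · exact i.elim
  · rfl

theorem sat_bsub {M : Type} [LA.Structure M] {k k' : ℕ} (φ : LA.BoundedFormula Empty k)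
    (σ : Fin k → LA.Term (Empty ⊕ Fin k')) (v : Fin k' → M) :
    Sat (bsub φ σ) v ↔ Sat φ (fun i => val v (σ i)) := by
  induction φ generalizing k' with
  | falsum => exact Iff.rfl
  | equal t s =>
    change val v (tsub t σ) = val v (tsub s σ) ↔ val _ t = val _ s
    rw [val_tsub, val_tsub]
  | rel R ts =>
    change Structure.RelMap R (fun i => val v (tsub (ts i) σ)) ↔
      Structure.RelMap R (fun i => val _ (ts i))
    simp only [val_tsub]
  | imp φ ψ ih₁ ih₂ =>
    change (Sat (bsub φ σ) v → Sat (bsub ψ σ) v) ↔ _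
    rw [ih₁, ih₂]
    rfl
  | all φ ih =>
    change (∀ a, Sat (bsub φ (liftS σ)) (Fin.snoc v a)) ↔ ∀ a, Sat φ (Fin.snoc _ a)
    refine forall_congr' fun a => ?_
    rw [ih]
    refine iff_of_eq (congrArg _ (funext fun i => ?_))
    refine Fin.lastCases ?_ (fun i => ?_) i
    · simp only [liftS, Fin.snoc_last]
      exact val_last v a
    · simp only [liftS, Fin.snoc_castSucc]
      exact val_liftT (σ i) v a

theorem tsub_liftT {k k' : ℕ} (t : LA.Term (Empty ⊕ Fin k))
    (σ : Fin k → LA.Term (Empty ⊕ Fin k')) : tsub (liftT t) (liftS σ) = liftT (tsub t σ) := by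
  induction t with
  | var i =>
    rcases i with i | i
    · exact i.elim
    · simp [tsub, liftT, liftS, Term.relabel, Term.subst]
  | func f ts ih =>
    simp only [tsub, liftT, Term.relabel, Term.subst] at ih ⊢
    exact congrArg _ (funext ih)

theorem bsub_leF {k k' : ℕ} (t : LA.Term (Empty ⊕ Fin k))
    (σ : Fin k → LA.Term (Empty ⊕ Fin k')) :
    bsub (leF (&(Fin.last k)) (liftT t)) (liftS σ) = leF (&(Fin.last k')) (liftT (tsub t σ)) := by
  unfold leF
  simp only [bsub]
  refine congrArg _ (funext fun i => ?_)
  fin_cases i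
  · simp [tsub, Term.subst, liftS]
  · exact tsub_liftT t σ

theorem Delta0.bsub {k k' : ℕ} {φ : LA.BoundedFormula Empty k} (h : Delta0 φ)
    (σ : Fin k → LA.Term (Empty ⊕ Fin k')) : Delta0 (bsub φ σ) := by
  induction h generalizing k' with
  | falsum => exact .falsum
  | equal t s => exact .equal _ _
  | le t s =>
    have : GRNonRE.bsub (leF t s) σ = leF (tsub t σ) (tsub s σ) := by
      unfold leF
      simp only [GRNonRE.bsub]
      refine congrArg _ (funext fun i => ?_)
      fin_cases i <;> rfl
    rw [this]
    exact .le _ _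
  | imp _ _ ih₁ ih₂ => exact .imp (ih₁ σ) (ih₂ σ)
  | bdall t _ ih =>
    have := Delta0.bdall (tsub t σ) (ih (liftS σ))
    rw [← bsub_leF] at this
    exact this

mutual

theorem IsSigma.bsub : ∀ {n k k' : ℕ} {φ : LA.BoundedFormula Empty k}, IsSigma n φ →
    ∀ σ : Fin k → LA.Term (Empty ⊕ Fin k'), IsSigma n (bsub φ σ)
  | _, _, _, _, .ofDelta0 h, σ => .ofDelta0 (h.bsub σ)
  | _, _, _, _, .ofPi h, σ => .ofPi (h.bsub σ)
  | _, _, _, _, .ex h, σ => .ex (h.bsub (liftS σ))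
  | _, _, _, _, .inf h₁ h₂, σ => .inf (h₁.bsub σ) (h₂.bsub σ)
  | _, _, _, _, .sup h₁ h₂, σ => .sup (h₁.bsub σ) (h₂.bsub σ)
  | _, _, _, _, .bdall t h, σ => by
    have := IsSigma.bdall (tsub t σ) (h.bsub (liftS σ))
    rw [← bsub_leF] at this
    exact this

theorem IsPi.bsub : ∀ {n k k' : ℕ} {φ : LA.BoundedFormula Empty k}, IsPi n φ →
    ∀ σ : Fin k → LA.Term (Empty ⊕ Fin k'), IsPi n (bsub φ σ)
  | _, _, _, _, .ofDelta0 h, σ => .ofDelta0 (h.bsub σ)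
  | _, _, _, _, .ofSigma h, σ => .ofSigma (h.bsub σ)
  | _, _, _, _, .all h, σ => .all (h.bsub (liftS σ))
  | _, _, _, _, .inf h₁ h₂, σ => .inf (h₁.bsub σ) (h₂.bsub σ)
  | _, _, _, _, .sup h₁ h₂, σ => .sup (h₁.bsub σ) (h₂.bsub σ)
  | _, _, _, _, .bdex t h, σ => by
    have := IsPi.bdex (tsub t σ) (h.bsub (liftS σ))
    rw [← bsub_leF] at this
    exact this

end

/-! ### Inclusions and duality in the arithmetical hierarchy -/

theorem Delta0.isSigma_and_isPi {k : ℕ} {φ : LA.BoundedFormula Empty k} (h : Delta0 φ) (n : ℕ) :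
    IsSigma n φ ∧ IsPi n φ := by
  induction n with
  | zero => exact ⟨.ofDelta0 h, .ofDelta0 h⟩
  | succ n ih => exact ⟨.ofPi ih.2, .ofSigma ih.1⟩

mutual

theorem IsSigma.succ : ∀ {n k : ℕ} {φ : LA.BoundedFormula Empty k}, IsSigma n φ → IsSigma (n + 1) φ
  | _, _, _, .ofDelta0 h => (h.isSigma_and_isPi _).1
  | _, _, _, .ofPi h => .ofPi h.succ
  | _, _, _, .ex h => .ex h.succ
  | _, _, _, .inf h₁ h₂ => .inf h₁.succ h₂.succ
  | _, _, _, .sup h₁ h₂ => .sup h₁.succ h₂.succ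
  | _, _, _, .bdall t h => .bdall t h.succ

theorem IsPi.succ : ∀ {n k : ℕ} {φ : LA.BoundedFormula Empty k}, IsPi n φ → IsPi (n + 1) φ
  | _, _, _, .ofDelta0 h => (h.isSigma_and_isPi _).2
  | _, _, _, .ofSigma h => .ofSigma h.succ
  | _, _, _, .all h => .all h.succ
  | _, _, _, .inf h₁ h₂ => .inf h₁.succ h₂.succ
  | _, _, _, .sup h₁ h₂ => .sup h₁.succ h₂.succ
  | _, _, _, .bdex t h => .bdex t h.succ

end

/-- `ψ` is equivalent to the negation of `φ` in every structure. -/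
def IsDual {k : ℕ} (φ ψ : LA.BoundedFormula Empty k) : Prop :=
  ∀ (M : Type) [LA.Structure M] (v : Fin k → M), Sat ψ v ↔ ¬ Sat φ v

mutual

theorem IsSigma.exists_dual : ∀ {n k : ℕ} {φ : LA.BoundedFormula Empty k}, IsSigma n φ →
    ∃ ψ, IsPi n ψ ∧ IsDual φ ψ
  | _, _, _, .ofDelta0 h => ⟨_, .ofDelta0 (.imp h .falsum), fun _ _ _ => Iff.rfl⟩
  | _, _, _, .ofPi h =>
    let ⟨_, hψ, hd⟩ := h.exists_dual
    ⟨_, .ofSigma hψ, hd⟩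
  | _, _, _, .ex h =>
    let ⟨_, hψ, hd⟩ := h.exists_dual
    ⟨_, .all hψ, fun M _ v => by simp only [Sat, realize_all, realize_ex, not_exists, ← hd M _]⟩
  | _, _, _, .inf h₁ h₂ =>
    let ⟨_, hψ₁, hd₁⟩ := h₁.exists_dual
    let ⟨_, hψ₂, hd₂⟩ := h₂.exists_dual
    ⟨_, .sup hψ₁ hψ₂, fun M _ v => by
      simp only [Sat, realize_sup, realize_inf, not_and_or, ← hd₁ M _, ← hd₂ M _]⟩
  | _, _, _, .sup h₁ h₂ =>
    let ⟨_, hψ₁, hd₁⟩ := h₁.exists_dual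
    let ⟨_, hψ₂, hd₂⟩ := h₂.exists_dual
    ⟨_, .inf hψ₁ hψ₂, fun M _ v => by
      simp only [Sat, realize_sup, realize_inf, not_or, ← hd₁ M _, ← hd₂ M _]⟩
  | _, _, _, .bdall t h =>
    let ⟨_, hψ, hd⟩ := h.exists_dual
    ⟨_, .bdex t hψ, fun M _ v => by
      rw [sat_bdex, sat_bdall]
      simp only [hd M _, not_forall, exists_prop]⟩

theorem IsPi.exists_dual : ∀ {n k : ℕ} {φ : LA.BoundedFormula Empty k}, IsPi n φ →
    ∃ ψ, IsSigma n ψ ∧ IsDual φ ψ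
  | _, _, _, .ofDelta0 h => ⟨_, .ofDelta0 (.imp h .falsum), fun _ _ _ => Iff.rfl⟩
  | _, _, _, .ofSigma h =>
    let ⟨_, hψ, hd⟩ := h.exists_dual
    ⟨_, .ofPi hψ, hd⟩
  | _, _, _, .all h =>
    let ⟨_, hψ, hd⟩ := h.exists_dual
    ⟨_, .ex hψ, fun M _ v => by simp only [Sat, realize_all, realize_ex, not_forall, ← hd M _]⟩
  | _, _, _, .inf h₁ h₂ =>
    let ⟨_, hψ₁, hd₁⟩ := h₁.exists_dual
    let ⟨_, hψ₂, hd₂⟩ := h₂.exists_dual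
    ⟨_, .sup hψ₁ hψ₂, fun M _ v => by
      simp only [Sat, realize_sup, realize_inf, not_and_or, ← hd₁ M _, ← hd₂ M _]⟩
  | _, _, _, .sup h₁ h₂ =>
    let ⟨_, hψ₁, hd₁⟩ := h₁.exists_dual
    let ⟨_, hψ₂, hd₂⟩ := h₂.exists_dual
    ⟨_, .inf hψ₁ hψ₂, fun M _ v => by
      simp only [Sat, realize_sup, realize_inf, not_or, ← hd₁ M _, ← hd₂ M _]⟩
  | _, _, _, .bdex t h =>
    let ⟨_, hψ, hd⟩ := h.exists_dual
    ⟨_, .bdall t hψ, fun M _ v => by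
      rw [sat_bdex, sat_bdall]
      simp only [hd M _, not_exists, not_and]⟩

end

/-! ### Arithmetical relations on `ℕ` -/

theorem le_nat (a b : ℕ) : Le a b ↔ a ≤ b := Iff.rfl

/-- `R` is definable in `ℕ` by a `Σ_{n+1}`-formula. -/
def SgR (n : ℕ) {k : ℕ} (R : (Fin k → ℕ) → Prop) : Prop :=
  ∃ φ : LA.BoundedFormula Empty k, IsSigma (n + 1) φ ∧ ∀ v, Sat φ v ↔ R v

namespace SgR

variable {n k k' : ℕ}

theorem of_iff {R S : (Fin k → ℕ) → Prop} (h : SgR n R) (hRS : ∀ v, R v ↔ S v) : SgR n S :=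
  (funext fun v => propext (hRS v) : R = S) ▸ h

theorem of_delta0 {φ : LA.BoundedFormula Empty k} (h : Delta0 φ) : SgR n fun v => Sat φ v :=
  ⟨φ, (h.isSigma_and_isPi _).1, fun _ => Iff.rfl⟩

theorem and {R S : (Fin k → ℕ) → Prop} (h : SgR n R) (h' : SgR n S) :
    SgR n fun v => R v ∧ S v :=
  let ⟨_, hφ, e⟩ := h
  let ⟨_, hφ', e'⟩ := h'
  ⟨_, hφ.inf hφ', fun v => by simp only [Sat, realize_inf, ← e, ← e']⟩

theorem or {R S : (Fin k → ℕ) → Prop} (h : SgR n R) (h' : SgR n S) :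
    SgR n fun v => R v ∨ S v :=
  let ⟨_, hφ, e⟩ := h
  let ⟨_, hφ', e'⟩ := h'
  ⟨_, hφ.sup hφ', fun v => by simp only [Sat, realize_sup, ← e, ← e']⟩

theorem ex {R : (Fin (k + 1) → ℕ) → Prop} (h : SgR n R) :
    SgR n fun v : Fin k → ℕ => ∃ a : ℕ, R (Fin.snoc v a) :=
  let ⟨_, hφ, e⟩ := h
  ⟨_, hφ.ex, fun v => by simp only [Sat, realize_ex, ← e]⟩

theorem ball {R : (Fin (k + 1) → ℕ) → Prop} (h : SgR n R) (t : LA.Term (Empty ⊕ Fin k)) :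
    SgR n fun v : Fin k → ℕ => ∀ a ≤ val v t, R (Fin.snoc v a) :=
  let ⟨_, hφ, e⟩ := h
  ⟨_, hφ.bdall t, fun v => by simp only [sat_bdall, e, le_nat]⟩

theorem rename {R : (Fin k → ℕ) → Prop} (h : SgR n R) (σ : Fin k → Fin k') :
    SgR n fun v : Fin k' → ℕ => R fun i => v (σ i) :=
  let ⟨_, hφ, e⟩ := h
  ⟨_, hφ.bsub fun i => &(σ i), fun v => by rw [sat_bsub, e]; rfl⟩

theorem equal (t s : LA.Term (Empty ⊕ Fin k)) : SgR n fun v : Fin k → ℕ => val v t = val v s :=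
  of_delta0 (.equal t s)

theorem le (t s : LA.Term (Empty ⊕ Fin k)) : SgR n fun v : Fin k → ℕ => val v t ≤ val v s :=
  (of_delta0 (.le t s)).of_iff fun v => sat_leF t s v

theorem natPair (i j l : Fin k) : SgR n fun v : Fin k → ℕ => v i = Nat.pair (v j) (v l) := by
  refine of_iff (or (and (le (succT (&j)) (&l)) (equal (&i) (addT (mulT (&l) (&l)) (&j))))
    (and (le (&l) (&j)) (equal (&i) (addT (addT (mulT (&j) (&j)) (&j)) (&l))))) fun v => ?_
  change (v j + 1 ≤ v l ∧ v i = v l * v l + v j) ∨ (v l ≤ v j ∧ v i = v j * v j + v j + v l) ↔ _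
  unfold Nat.pair
  split_ifs with h
  · have h₁ : v j + 1 ≤ v l := h
    have h₂ : ¬ v l ≤ v j := by omega
    simp [h₁, h₂]
  · have h₁ : ¬ v j + 1 ≤ v l := h
    have h₂ : v l ≤ v j := by omega
    simp [h₁, h₂]

end SgR

/-- The predicate `P` is definable in `ℕ` by a `Σ_{n+1}`-formula. -/
def SgN (n : ℕ) (P : ℕ → Prop) : Prop := SgR n fun v : Fin 1 → ℕ => P (v 0)

/-- The graph of `f` is definable in `ℕ` by a `Σ_{n+1}`-formula. -/
def SgF (n : ℕ) (f : ℕ → ℕ) : Prop := SgN n fun z => z.unpair.2 = f z.unpair.1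

namespace SgN

variable {n : ℕ} {P Q : ℕ → Prop}

theorem of_iff (h : SgN n P) (hPQ : ∀ m, P m ↔ Q m) : SgN n Q := SgR.of_iff h fun v => hPQ (v 0)

theorem and (h : SgN n P) (h' : SgN n Q) : SgN n fun m => P m ∧ Q m := SgR.and h h'

theorem or (h : SgN n P) (h' : SgN n Q) : SgN n fun m => P m ∨ Q m := SgR.or h h'

theorem at_var (h : SgN n P) {k : ℕ} (i : Fin k) : SgR n fun v : Fin k → ℕ => P (v i) :=
  SgR.rename h fun _ => i

theorem fst (h : SgN n P) : SgN n fun z => P z.unpair.1 := by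
  refine SgR.of_iff (((SgR.natPair 0 1 2).and (h.at_var (1 : Fin 3))).ex.ex) fun v => ?_
  change (∃ a b, v 0 = Nat.pair a b ∧ P a) ↔ _
  constructor
  · rintro ⟨a, b, e, h⟩
    simpa [e] using h
  · exact fun h => ⟨_, _, (Nat.pair_unpair _).symm, h⟩

theorem snd (h : SgN n P) : SgN n fun z => P z.unpair.2 := by
  refine SgR.of_iff (((SgR.natPair 0 1 2).and (h.at_var (2 : Fin 3))).ex.ex) fun v => ?_
  change (∃ a b, v 0 = Nat.pair a b ∧ P b) ↔ _
  constructor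
  · rintro ⟨a, b, e, h⟩
    simpa [e] using h
  · exact fun h => ⟨_, _, (Nat.pair_unpair _).symm, h⟩

theorem ex {R : ℕ → ℕ → Prop} (h : SgN n fun z => R z.unpair.1 z.unpair.2) :
    SgN n fun x => ∃ y, R x y := by
  refine SgR.of_iff (((SgR.natPair 2 0 1).and (h.at_var (2 : Fin 3))).ex.ex) fun v => ?_
  change (∃ a b, b = Nat.pair (v 0) a ∧ R b.unpair.1 b.unpair.2) ↔ _
  simp

theorem ball {R : ℕ → ℕ → Prop} (h : SgN n fun z => R z.unpair.1 z.unpair.2) :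
    SgN n fun z => ∀ y < z.unpair.2, R z.unpair.1 y := by
  have h₁ : SgR n fun v : Fin 4 → ℕ => v 2 ≤ v 3 ∨ ∃ c, c = Nat.pair (v 1) (v 3) ∧
      R c.unpair.1 c.unpair.2 :=
    (SgR.le (&2) (&3)).or ((SgR.natPair 4 1 3).and (h.at_var (4 : Fin 5))).ex
  refine SgR.of_iff (((SgR.natPair 0 1 2).and (h₁.ball (&2))).ex.ex) fun v => ?_
  change (∃ a b, v 0 = Nat.pair a b ∧ ∀ y ≤ b, (b ≤ y ∨ ∃ c, c = Nat.pair a y ∧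
    R c.unpair.1 c.unpair.2)) ↔ _
  simp only [exists_eq_left, Nat.unpair_pair]
  constructor
  · rintro ⟨a, b, e, h⟩
    simp only [e, Nat.unpair_pair]
    exact fun y hy => (h y hy.le).resolve_left hy.not_ge
  · exact fun h => ⟨_, _, (Nat.pair_unpair _).symm, fun y _ =>
      (le_or_gt _ y).imp_right fun hy => h y hy⟩

theorem comp {f : ℕ → ℕ} (h : SgN n P) (hf : SgF n f) : SgN n fun x => P (f x) :=
  (ex (R := fun x y => y = f x ∧ P y) (and hf h.snd)).of_iff fun x => by simp

theorem eq_unpair : SgN n fun z => z.unpair.1 = z.unpair.2 := by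
  refine SgR.of_iff (((SgR.natPair 0 1 1)).ex) fun v => ?_
  change (∃ a, v 0 = Nat.pair a a) ↔ _
  constructor
  · rintro ⟨a, e⟩
    simp [e]
  · intro h
    exact ⟨(v 0).unpair.1, by conv_lhs => rw [← Nat.pair_unpair (v 0), ← h]⟩

theorem lt_unpair : SgN n fun z => z.unpair.1 < z.unpair.2 := by
  refine SgR.of_iff ((((SgR.natPair 0 1 2).and (SgR.le (succT (&1)) (&(2 : Fin 3)))).ex).ex)
    fun v => ?_
  change (∃ a b, v 0 = Nat.pair a b ∧ a < b) ↔ _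
  constructor
  · rintro ⟨a, b, e, h⟩
    simpa [e] using h
  · intro h
    exact ⟨_, _, (Nat.pair_unpair _).symm, h⟩

end SgN

namespace SgF

variable {n : ℕ} {f g : ℕ → ℕ}

theorem of_eq (h : SgF n f) (hfg : ∀ x, f x = g x) : SgF n g :=
  (funext hfg : f = g) ▸ h

theorem zero : SgF n fun _ => 0 :=
  SgN.snd (P := fun m => m = 0) (SgR.equal (&0) zeroT)

theorem succ : SgF n Nat.succ := by
  refine SgR.of_iff ((((SgR.natPair 0 1 2).and (SgR.equal (&(2 : Fin 3)) (succT (&1)))).ex).ex)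
    fun v => ?_
  change (∃ a b, v 0 = Nat.pair a b ∧ b = a + 1) ↔ _
  constructor
  · rintro ⟨a, b, e, h⟩
    simpa [e] using h
  · intro h
    exact ⟨_, _, (Nat.pair_unpair _).symm, h⟩

theorem comp (hf : SgF n f) (hg : SgF n g) : SgF n fun x => f (g x) := by
  refine (SgN.ex (R := fun z y => y = g z.unpair.1 ∧ z.unpair.2 = f y) (SgN.and ?_ ?_)).of_iff
    fun z => by simp
  · have h₁ : SgR n fun v : Fin 6 → ℕ => (v 5).unpair.2 = g (v 5).unpair.1 :=
      SgN.at_var (P := fun m => m.unpair.2 = g m.unpair.1) hg (5 : Fin 6)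
    refine SgR.of_iff ((((((SgR.natPair 0 1 2).and (SgR.natPair 1 3 4)).and
      ((SgR.natPair 5 3 2).and h₁)).ex.ex).ex.ex).ex) fun v => ?_
    change (∃ a b c d e, (v 0 = Nat.pair a b ∧ a = Nat.pair c d) ∧ e = Nat.pair c b ∧
      e.unpair.2 = g e.unpair.1) ↔ _
    constructor
    · rintro ⟨a, b, c, d, e, ⟨h₁, rfl⟩, rfl, h₂⟩
      simpa [h₁] using h₂
    · exact fun h => ⟨_, _, _, _, _, ⟨(Nat.pair_unpair _).symm, (Nat.pair_unpair _).symm⟩, rfl,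
        by simpa using h⟩
  · have h₁ : SgR n fun v : Fin 6 → ℕ => (v 5).unpair.2 = f (v 5).unpair.1 :=
      SgN.at_var (P := fun m => m.unpair.2 = f m.unpair.1) hf (5 : Fin 6)
    refine SgR.of_iff ((((((SgR.natPair 0 1 2).and (SgR.natPair 1 3 4)).and
      ((SgR.natPair 5 2 4).and h₁)).ex.ex).ex.ex).ex) fun v => ?_
    change (∃ a b c d e, (v 0 = Nat.pair a b ∧ a = Nat.pair c d) ∧ e = Nat.pair b d ∧
      e.unpair.2 = f e.unpair.1) ↔ _
    constructor
    · rintro ⟨a, b, c, d, e, ⟨h₁, rfl⟩, rfl, h₂⟩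
      simpa [h₁] using h₂
    · exact fun h => ⟨_, _, _, _, _, ⟨(Nat.pair_unpair _).symm, (Nat.pair_unpair _).symm⟩, rfl,
        by simpa using h⟩

theorem pair (hf : SgF n f) (hg : SgF n g) : SgF n fun x => Nat.pair (f x) (g x) := by
  have h₁ : SgR n fun v : Fin 7 → ℕ => (v 5).unpair.2 = f (v 5).unpair.1 :=
    SgN.at_var (P := fun m => m.unpair.2 = f m.unpair.1) hf (5 : Fin 7)
  have h₂ : SgR n fun v : Fin 7 → ℕ => (v 6).unpair.2 = g (v 6).unpair.1 :=
    SgN.at_var (P := fun m => m.unpair.2 = g m.unpair.1) hg (6 : Fin 7)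
  refine SgR.of_iff (((((((SgR.natPair 0 1 2).and (SgR.natPair 2 3 4)).and
      ((SgR.natPair 5 1 3).and h₁)).and ((SgR.natPair 6 1 4).and h₂)).ex.ex).ex.ex).ex.ex)
      fun v => ?_
  change (∃ a b c d e e', ((v 0 = Nat.pair a b ∧ b = Nat.pair c d) ∧ e = Nat.pair a c ∧
    e.unpair.2 = f e.unpair.1) ∧ e' = Nat.pair a d ∧ e'.unpair.2 = g e'.unpair.1) ↔ _
  constructor
  · rintro ⟨a, b, c, d, e, e', ⟨⟨h₁, rfl⟩, rfl, h₂⟩, rfl, h₃⟩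
    simp only [Nat.unpair_pair] at h₂ h₃
    simp [h₁, h₂, h₃]
  · intro h
    refine ⟨_, _, _, _, _, _, ⟨⟨(Nat.pair_unpair _).symm, (Nat.pair_unpair _).symm⟩, rfl, ?_⟩,
      rfl, ?_⟩ <;> simp [h]

theorem left : SgF n fun z => z.unpair.1 := by
  refine SgR.of_iff (((SgR.natPair 0 1 2).and (SgR.natPair 1 2 3)).ex.ex.ex) fun v => ?_
  change (∃ a b c, v 0 = Nat.pair a b ∧ a = Nat.pair b c) ↔ _
  constructor
  · rintro ⟨a, b, c, h, rfl⟩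
    simp [h]
  · intro h
    exact ⟨_, _, (v 0).unpair.1.unpair.2, (Nat.pair_unpair _).symm, by rw [h, Nat.pair_unpair]⟩

theorem right : SgF n fun z => z.unpair.2 := by
  refine SgR.of_iff (((SgR.natPair 0 1 2).and (SgR.natPair 1 3 2)).ex.ex.ex) fun v => ?_
  change (∃ a b c, v 0 = Nat.pair a b ∧ a = Nat.pair c b) ↔ _
  constructor
  · rintro ⟨a, b, c, h, rfl⟩
    simp [h]
  · intro h
    exact ⟨_, _, (v 0).unpair.1.unpair.1, (Nat.pair_unpair _).symm, by rw [h, Nat.pair_unpair]⟩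

theorem eq (hf : SgF n f) (hg : SgF n g) : SgN n fun x => f x = g x :=
  (SgN.eq_unpair.comp (hf.pair hg)).of_iff fun x => by simp

theorem lt (hf : SgF n f) (hg : SgF n g) : SgN n fun x => f x < g x :=
  (SgN.lt_unpair.comp (hf.pair hg)).of_iff fun x => by simp

theorem beta (hf : SgF n f) (hg : SgF n g) : SgF n fun x => Nat.beta (f x) (g x) := by
  suffices h : SgF n fun z => Nat.beta z.unpair.1 z.unpair.2 from
    (h.comp (hf.pair hg)).of_eq fun x => by simp
  have h₁ : SgR n fun v : Fin 8 → ℕ => v 5 = v 7 * ((v 4 + 1) * v 6 + 1) + v 2 :=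
    SgR.equal (&5) (addT (mulT (&7) (succT (mulT (succT (&4)) (&6)))) (&2))
  have h₂ : SgR n fun v : Fin 8 → ℕ => v 2 ≤ (v 4 + 1) * v 6 :=
    SgR.le (&2) (mulT (succT (&4)) (&6))
  refine SgR.of_iff ((((((SgR.natPair 0 1 2).and ((SgR.natPair 1 3 4).and (SgR.natPair 3 5 6))).and
      (h₁.and h₂)).ex.ex).ex.ex).ex.ex.ex) fun v => ?_
  change (∃ z r s i a b q, (v 0 = Nat.pair z r ∧ z = Nat.pair s i ∧ s = Nat.pair a b) ∧
    a = q * ((i + 1) * b + 1) + r ∧ r ≤ (i + 1) * b) ↔ _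
  constructor
  · rintro ⟨z, r, s, i, a, b, q, ⟨h₁, rfl, rfl⟩, h₂, h₃⟩
    simp only [h₁, Nat.unpair_pair, Nat.beta]
    rw [h₂, Nat.mul_comm q, Nat.mul_add_mod, Nat.mod_eq_of_lt (by omega)]
  · intro h
    simp only [Nat.beta] at h
    refine ⟨_, _, _, _, _, _, _, ⟨(Nat.pair_unpair _).symm, (Nat.pair_unpair _).symm,
      (Nat.pair_unpair _).symm⟩, h ▸ (Nat.div_add_mod' _ _).symm, ?_⟩
    rw [h]
    exact Nat.le_of_lt_succ (Nat.mod_lt _ (Nat.succ_pos _))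

theorem prec (hf : SgF n f) (hg : SgF n g) : SgF n (Nat.unpaired fun z m =>
    Nat.rec (f z) (fun y IH => g (Nat.pair z (Nat.pair y IH))) m) := by
  have hs : SgF n fun z => z.unpair.2 := right
  have hz : SgF n fun z => z.unpair.1.unpair.1.unpair.1 := left.comp (left.comp left)
  have hm : SgF n fun z => z.unpair.1.unpair.1.unpair.2 := right.comp (left.comp left)
  have hr : SgF n fun z => z.unpair.1.unpair.2 := right.comp left
  have hz' : SgF n fun w => w.unpair.1.unpair.1.unpair.1.unpair.1 := hz.comp left
  have hs' : SgF n fun w => w.unpair.1.unpair.2 := hs.comp left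
  have hy : SgF n fun w => w.unpair.2 := right
  have hstep := SgN.ball (R := fun z y => Nat.beta z.unpair.2 (y + 1) =
    g (Nat.pair z.unpair.1.unpair.1.unpair.1 (Nat.pair y (Nat.beta z.unpair.2 y))))
    ((beta hs' (succ.comp hy)).eq (hg.comp (hz'.pair (hy.pair (beta hs' hy)))))
  have hid : SgF n fun x => x := (left.pair right).of_eq Nat.pair_unpair
  have hstep' := hstep.comp (hid.pair hm)
  refine (SgN.ex (R := fun w s => Nat.beta s 0 = f w.unpair.1.unpair.1 ∧
    (∀ y < w.unpair.1.unpair.2, Nat.beta s (y + 1) =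
      g (Nat.pair w.unpair.1.unpair.1 (Nat.pair y (Nat.beta s y)))) ∧
    Nat.beta s w.unpair.1.unpair.2 = w.unpair.2)
    (((beta hs zero).eq (hf.comp hz)).and ((hstep'.of_iff fun x => by simp).and
      ((beta hs hm).eq hr)))).of_iff fun w => ?_
  set z := w.unpair.1.unpair.1
  set m := w.unpair.1.unpair.2
  set F : ℕ → ℕ := fun m => Nat.rec (f z) (fun y IH => g (Nat.pair z (Nat.pair y IH))) m
  change _ ↔ w.unpair.2 = F m
  constructor
  · rintro ⟨s, h₀, h₁, h₂⟩
    have : ∀ y ≤ m, Nat.beta s y = F y := by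
      intro y
      induction y with
      | zero => exact fun _ => h₀
      | succ y ih =>
        intro hy
        rw [h₁ y hy, ih (by omega)]
    rw [← h₂, this m le_rfl]
  · intro h
    have hl : ∀ y ≤ m, Nat.beta (Nat.unbeta ((List.range (m + 1)).map F)) y = F y := by
      intro y hy
      have := Nat.beta_unbeta_coe ((List.range (m + 1)).map F) ⟨y, by simp; omega⟩
      simpa using this
    refine ⟨Nat.unbeta ((List.range (m + 1)).map F), hl 0 (Nat.zero_le _), fun y hy => ?_, ?_⟩
    · rw [hl _ hy, hl _ (le_of_lt hy)]
    · rw [hl _ le_rfl, h]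

theorem of_primrec (h : Nat.Primrec f) : SgF n f := by
  induction h with
  | zero => exact zero
  | succ => exact succ
  | left => exact left
  | right => exact right
  | pair _ _ h₁ h₂ => exact h₁.pair h₂
  | comp _ _ h₁ h₂ => exact h₁.comp h₂
  | prec _ _ h₁ h₂ => exact h₁.prec h₂

end SgF

/-! ### `Σ_{n+1}`-predicates on encodable types -/

/-- The predicate `P` on a primitively encoded type is definable in `ℕ` by a
`Σ_{n+1}`-formula. -/
def Sg (n : ℕ) {γ : Type} [Primcodable γ] (P : γ → Prop) : Prop :=
  SgN n fun m => ∃ c ∈ (Encodable.decode m : Option γ), P c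

namespace Sg

variable {n : ℕ} {γ δ : Type} [Primcodable γ] [Primcodable δ] {P Q : γ → Prop}

theorem of_iff (h : Sg n P) (hPQ : ∀ c, P c ↔ Q c) : Sg n Q :=
  (funext fun c => propext (hPQ c) : P = Q) ▸ h

theorem of_sgN {P : ℕ → Prop} (h : SgN n P) : Sg n P := SgN.of_iff h fun m => by simp

theorem sgN {P : ℕ → Prop} (h : Sg n P) : SgN n P := SgN.of_iff h fun m => by simp

theorem and (h : Sg n P) (h' : Sg n Q) : Sg n fun c => P c ∧ Q c :=
  (SgN.and h h').of_iff fun m => by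
    cases (Encodable.decode m : Option γ) <;> simp

theorem or (h : Sg n P) (h' : Sg n Q) : Sg n fun c => P c ∨ Q c :=
  (SgN.or h h').of_iff fun m => by
    cases (Encodable.decode m : Option γ) <;> simp

theorem comp {P : δ → Prop} {f : γ → δ} (h : Sg n P) (hf : Primrec f) :
    Sg n fun c => P (f c) := by
  have hf' : SgF n fun m => Encodable.encode ((Encodable.decode m : Option γ).map f) :=
    SgF.of_primrec hf
  refine ((SgF.zero.lt hf').and (SgN.comp h ((SgF.of_primrec Nat.Primrec.pred).comp hf'))).of_iff
    fun m => ?_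
  cases (Encodable.decode m : Option γ) <;> simp

theorem of_primrec (h : PrimrecPred P) : Sg n P := by
  obtain ⟨_, h⟩ := h
  have h' : SgF n fun m => Encodable.encode
      ((Encodable.decode m : Option γ).map fun c => decide (P c)) := SgF.of_primrec h
  refine (h'.eq (SgF.of_primrec (Nat.Primrec.const 2))).of_iff fun m => ?_
  cases (Encodable.decode m : Option γ) with
  | none => simp
  | some c => by_cases hc : P c <;> simp [hc]

theorem ex {R : γ → δ → Prop} (h : Sg n fun p : γ × δ => R p.1 p.2) :
    Sg n fun c => ∃ d, R c d := by
  refine (SgN.ex (R := fun x y => ∃ p ∈ (Encodable.decode (Nat.pair x y) : Option (γ × δ)),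
    R p.1 p.2) (SgN.of_iff h fun m => by simp only [Nat.pair_unpair])).of_iff fun m => ?_
  simp only [Encodable.decode_prod_val, Nat.unpair_pair]
  cases (Encodable.decode m : Option γ) with
  | none => simp
  | some c =>
    simp only [Option.bind_some, Option.mem_def, Option.map_eq_some_iff, Option.some.injEq,
      exists_eq_left']
    constructor
    · rintro ⟨y, _, ⟨d, _, rfl⟩, h⟩
      exact ⟨d, h⟩
    · rintro ⟨d, h⟩
      exact ⟨Encodable.encode d, (c, d), ⟨d, by simp, rfl⟩, h⟩

theorem exists_snd {P : γ × δ → Prop} (h : Sg n P) : Sg n fun c => ∃ d, P (c, d) :=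
  ex (R := fun c d => P (c, d)) h

theorem ball {R : γ → ℕ → Prop} (h : Sg n fun p : γ × ℕ => R p.1 p.2) {f : γ → ℕ}
    (hf : Primrec f) : Sg n fun c => ∀ y < f c, R c y := by
  suffices h' : Sg n fun p : γ × ℕ => ∀ y < p.2, R p.1 y from
    h'.comp (Primrec.id.pair hf)
  have ht : Sg n fun _ : γ × ℕ => True := of_primrec ⟨fun _ => .isTrue trivial, by
    simpa using Primrec.const true⟩
  refine (SgN.and ht (SgN.ball (R := fun x y =>
    ∃ p ∈ (Encodable.decode (Nat.pair x y) : Option (γ × ℕ)), R p.1 p.2)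
    (SgN.of_iff h fun m => by simp only [Nat.pair_unpair]))).of_iff fun m => ?_
  simp only [Encodable.decode_prod_val, Nat.unpair_pair]
  cases (Encodable.decode m.unpair.1 : Option γ) <;> simp

theorem eq {f g : γ → δ} (hf : Primrec f) (hg : Primrec g) : Sg n fun c => f c = g c :=
  of_primrec (by classical exact Primrec.eq.comp hf hg)

theorem lt {f g : γ → ℕ} (hf : Primrec f) (hg : Primrec g) : Sg n fun c => f c < g c :=
  of_primrec (Primrec.nat_lt.comp hf hg)

end Sg

/-- The least predicate containing `B` and closed under the two-premise rule `C`, where `C z y y'`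
allows to infer `z` from `y` and `y'`. -/
inductive Closure {γ : Type} (B : γ → Prop) (C : γ → γ → γ → Prop) : γ → Prop
  | base {z : γ} : B z → Closure B C z
  | step {z y y' : γ} : C z y y' → Closure B C y → Closure B C y' → Closure B C z

/-- `l` is a derivation (read from right to left) for the predicate `Closure B C`. -/
def Derivation {γ : Type} (B : γ → Prop) (C : γ → γ → γ → Prop) : List γ → Prop
  | [] => True
  | z :: l => (B z ∨ ∃ y ∈ l, ∃ y' ∈ l, C z y y') ∧ Derivation B C l

namespace Derivation

variable {γ : Type} {B : γ → Prop} {C : γ → γ → γ → Prop}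

theorem append : ∀ {l l' : List γ}, Derivation B C l → Derivation B C l' →
    Derivation B C (l ++ l')
  | [], _, _, h' => h'
  | _ :: _, _, h, h' => ⟨h.1.imp_right fun ⟨y, hy, y', hy', hc⟩ =>
      ⟨y, List.mem_append_left _ hy, y', List.mem_append_left _ hy', hc⟩, append h.2 h'⟩

theorem closure : ∀ {l : List γ}, Derivation B C l → ∀ z ∈ l, Closure B C z
  | [], _ => by simp
  | z :: l, h => by
    have ih := closure h.2
    rintro x (_ | ⟨_, hx⟩)
    · obtain hb | ⟨y, hy, y', hy', hc⟩ := h.1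
      · exact .base hb
      · exact .step hc (ih y hy) (ih y' hy')
    · exact ih x hx

theorem exists_of_closure {z : γ} (h : Closure B C z) : ∃ l, Derivation B C l ∧ z ∈ l := by
  induction h with
  | @base z h => exact ⟨[z], ⟨.inl h, trivial⟩, by simp⟩
  | @step z y y' h _ _ ih ih' =>
    obtain ⟨l, hl, hy⟩ := ih
    obtain ⟨l', hl', hy'⟩ := ih'
    exact ⟨z :: (l ++ l'), ⟨.inr ⟨y, by simp [hy], y', by simp [hy'], h⟩, hl.append hl'⟩, by simp⟩

theorem iff_forall {l : List γ} : Derivation B C l ↔ ∀ i < l.length, ∃ z, l[i]? = some z ∧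
    (B z ∨ ∃ y y', (∃ j, i < j ∧ l[j]? = some y) ∧ (∃ j, i < j ∧ l[j]? = some y') ∧ C z y y') := by
  induction l with
  | nil => simp [Derivation]
  | cons z l ih =>
    have hmem : ∀ y, (∃ j, 0 < j ∧ (z :: l)[j]? = some y) ↔ y ∈ l := by
      intro y
      rw [List.mem_iff_getElem?]
      exact ⟨fun ⟨j, hj, h⟩ => ⟨j - 1, by cases j <;> simp_all⟩, fun ⟨j, h⟩ => ⟨j + 1, by simpa⟩⟩
    have hsucc : ∀ y i, (∃ j, i + 1 < j ∧ (z :: l)[j]? = some y) ↔ ∃ j, i < j ∧ l[j]? = some y := by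
      intro y i
      exact ⟨fun ⟨j, hj, h⟩ => ⟨j - 1, by cases j <;> simp_all⟩,
        fun ⟨j, hj, h⟩ => ⟨j + 1, by simpa using ⟨hj, h⟩⟩⟩
    rw [Derivation, ih]
    constructor
    · rintro ⟨h₀, h⟩ (_ | i) hi
      · refine ⟨z, rfl, h₀.imp_right ?_⟩
        rintro ⟨y, hy, y', hy', hc⟩
        exact ⟨y, y', (hmem y).2 hy, (hmem y').2 hy', hc⟩
      · simp only [hsucc, List.getElem?_cons_succ]
        exact h i (by simpa using hi)
    · intro h
      refine ⟨?_, fun i hi => ?_⟩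
      · obtain ⟨x, hx, h'⟩ := h 0 (by simp)
        simp only [hmem] at h'
        obtain rfl : z = x := by simpa using hx
        exact h'.imp_right fun ⟨y, y', hy, hy', hc⟩ => ⟨y, hy, y', hy', hc⟩
      · simpa only [hsucc, List.getElem?_cons_succ] using h (i + 1) (by simpa using hi)

end Derivation

theorem Sg.closure {n : ℕ} {γ : Type} [Primcodable γ] {B : γ → Prop} {C : γ → γ → γ → Prop}
    (hB : Sg n B) (hC : Sg n fun p : γ × γ × γ => C p.1 p.2.1 p.2.2) : Sg n (Closure B C) := by
  have hget : Sg n fun p : (List γ × ℕ) × γ => p.1.1[p.1.2]? = some p.2 :=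
    .eq (Primrec.list_getElem?.comp (Primrec.fst.comp .fst) (Primrec.snd.comp .fst))
      (Primrec.option_some.comp .snd)
  have hlater : Sg n fun p : (List γ × ℕ) × γ => ∃ j, p.1.2 < j ∧ p.1.1[j]? = some p.2 :=
    .ex (.and (.lt (Primrec.snd.comp (Primrec.fst.comp .fst)) .snd)
      (hget.comp (f := fun q : ((List γ × ℕ) × γ) × ℕ => ((q.1.1.1, q.2), q.1.2))
        (((Primrec.fst.comp (Primrec.fst.comp .fst)).pair .snd).pair (Primrec.snd.comp .fst))))
  have hD : Sg n (Derivation B C) := by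
    refine of_iff (.ball (f := List.length) (R := fun l i => ∃ z, l[i]? = some z ∧ (B z ∨
      ∃ y y', (∃ j, i < j ∧ l[j]? = some y) ∧ (∃ j, i < j ∧ l[j]? = some y') ∧ C z y y'))
      (.ex (.and hget (.or (hB.comp .snd) (.ex (.ex (.and ?_ (.and ?_ ?_)))))))
      Primrec.list_length) fun l => Derivation.iff_forall.symm
    · exact hlater.comp (f := fun q : ((((List γ × ℕ) × γ) × γ) × γ) => (q.1.1.1, q.1.2))
        ((Primrec.fst.comp (Primrec.fst.comp .fst)).pair (Primrec.snd.comp .fst))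
    · exact hlater.comp (f := fun q : ((((List γ × ℕ) × γ) × γ) × γ) => (q.1.1.1, q.2))
        ((Primrec.fst.comp (Primrec.fst.comp .fst)).pair .snd)
    · exact hC.comp (f := fun q : ((((List γ × ℕ) × γ) × γ) × γ) => (q.1.1.2, q.1.2, q.2))
        ((Primrec.snd.comp (Primrec.fst.comp .fst)).pair ((Primrec.snd.comp .fst).pair .snd))
  have hmem : Sg n fun p : γ × List γ => ∃ i, p.2[i]? = some p.1 :=
    .ex (hget.comp (f := fun q : (γ × List γ) × ℕ => ((q.1.2, q.2), q.1.1))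
      (((Primrec.snd.comp .fst).pair .snd).pair (Primrec.fst.comp .fst)))
  refine of_iff (.ex (R := fun z l => Derivation B C l ∧ ∃ i, l[i]? = some z)
    (.and (hD.comp .snd) hmem)) fun z => ?_
  simp only [← List.mem_iff_getElem?]
  exact ⟨fun ⟨l, hl, hz⟩ => hl.closure z hz, Derivation.exists_of_closure⟩

/-! ### Codes of terms and formulas as lists of natural numbers -/

/-- The code of a term as a list of natural numbers. -/
def tcode {k : ℕ} (t : LA.Term (Empty ⊕ Fin k)) : List ℕ := t.listEncode.map Encodable.encode

/-- The code of a formula as a list of natural numbers. -/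
def code {k : ℕ} (φ : LA.BoundedFormula Empty k) : List ℕ := φ.listEncode.map Encodable.encode

theorem encode_map_encode {γ : Type} [Encodable γ] (l : List γ) :
    Encodable.encode (l.map Encodable.encode) = Encodable.encode l := by
  induction l with
  | nil => rfl
  | cons a l ih => simp [ih]

theorem encode_code {k : ℕ} (φ : LA.BoundedFormula Empty k) : Encodable.encode (code φ) = godel φ :=
  encode_map_encode _

theorem code_injective {k k' : ℕ} {φ : LA.BoundedFormula Empty k}
    {ψ : LA.BoundedFormula Empty k'} (h : code φ = code ψ) :
    (⟨k, φ⟩ : Σ k, LA.BoundedFormula Empty k) = ⟨k', ψ⟩ :=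
  listEncode_sigma_injective (List.map_injective_iff.2 Encodable.encode_injective h)

variable {k : ℕ}

theorem tcode_var (i : Fin k) : tcode (Term.var (Sum.inr i) : LA.Term (Empty ⊕ Fin k)) =
    [4 * (i : ℕ) + 2] := by
  change [2 * (2 * (i : ℕ) + 1)] = _
  ring_nf

theorem tcode_zero (ts : Fin 0 → LA.Term (Empty ⊕ Fin k)) :
    tcode (Term.func ArithFunc.zero ts) = [1] := rfl

theorem tcode_succ (ts : Fin 1 → LA.Term (Empty ⊕ Fin k)) :
    tcode (Term.func ArithFunc.succ ts) = 3 :: tcode (ts 0) := by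
  simp [tcode, Term.listEncode, List.finRange_succ]
  rfl

theorem tcode_add (ts : Fin 2 → LA.Term (Empty ⊕ Fin k)) :
    tcode (Term.func ArithFunc.add ts) = 5 :: (tcode (ts 0) ++ tcode (ts 1)) := by
  simp [tcode, Term.listEncode, List.finRange_succ]
  rfl

theorem tcode_mul (ts : Fin 2 → LA.Term (Empty ⊕ Fin k)) :
    tcode (Term.func ArithFunc.mul ts) = 7 :: (tcode (ts 0) ++ tcode (ts 1)) := by
  simp [tcode, Term.listEncode, List.finRange_succ]
  rfl

/-- The symbol, in the code of a formula, for the code `x` of a term in context `k`. -/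
def termSym (k : ℕ) (x : List ℕ) : ℕ := 2 * Nat.pair k (Encodable.encode x)

theorem encode_term (t : LA.Term (Empty ⊕ Fin k)) :
    Encodable.encode (Sum.inl ⟨k, t⟩ : (Σ k, LA.Term (Empty ⊕ Fin k)) ⊕ ((Σ n, LA.Relations n) ⊕ ℕ))
      = termSym k (tcode t) := by
  rw [termSym, tcode, encode_map_encode]
  rfl

theorem code_falsum : code (falsum : LA.BoundedFormula Empty k) = [4 * k + 11] := by
  change [2 * (2 * (k + 2) + 1) + 1] = _
  ring_nf

theorem code_equal (t s : LA.Term (Empty ⊕ Fin k)) :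
    code (BoundedFormula.equal t s) = [termSym k (tcode t), termSym k (tcode s)] := by
  simp only [code, BoundedFormula.listEncode, List.map_cons, encode_term, List.map_nil]

theorem code_rel (ts : Fin 2 → LA.Term (Empty ⊕ Fin k)) :
    code (BoundedFormula.rel ArithRel.le ts) =
      [1, 4 * k + 3, termSym k (tcode (ts 0)), termSym k (tcode (ts 1))] := by
  have h : 4 * k + 3 = 2 * (2 * k + 1) + 1 := by ring
  rw [← encode_term, ← encode_term, h]
  rfl

theorem code_leF (t s : LA.Term (Empty ⊕ Fin k)) :
    code (leF t s) = [1, 4 * k + 3, termSym k (tcode t), termSym k (tcode s)] :=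
  code_rel _

theorem code_imp (φ ψ : LA.BoundedFormula Empty k) :
    code (φ.imp ψ) = 3 :: (code φ ++ code ψ) := by
  simp [code, BoundedFormula.listEncode]

theorem code_all (φ : LA.BoundedFormula Empty (k + 1)) : code φ.all = 7 :: code φ := by
  simp [code, BoundedFormula.listEncode]

/-! ### The universe of closed Henkin terms -/

/-- The universe of closed terms built from `0`, `S`, `+`, `×` and Henkin constants `hW c`, `c : ℕ`,
coded by natural numbers. -/
def Herb : Type := ℕ

/-- The code of the successor of a closed Henkin term. -/
def hS (a : ℕ) : ℕ := 4 * a + 1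

/-- The code of the sum of two closed Henkin terms. -/
def hA (a b : ℕ) : ℕ := 4 * Nat.pair a b + 2

/-- The code of the product of two closed Henkin terms. -/
def hM (a b : ℕ) : ℕ := 4 * Nat.pair a b + 3

/-- The code of the `c`-th Henkin constant. -/
def hW (c : ℕ) : ℕ := 4 * c + 4

/-- The code of the numeral of `m` as a closed Henkin term. -/
def hNum : ℕ → ℕ
  | 0 => 0
  | m + 1 => hS (hNum m)

instance : LA.Structure Herb where
  funMap {_} f := match f with
    | ArithFunc.zero => fun _ => (0 : ℕ)
    | ArithFunc.succ => fun v => hS (v 0)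
    | ArithFunc.add => fun v => hA (v 0) (v 1)
    | ArithFunc.mul => fun v => hM (v 0) (v 1)
  RelMap {_} _ _ := False

/-- The value of a term in the universe of closed Henkin terms. -/
def hval {k : ℕ} (v : Fin k → ℕ) (t : LA.Term (Empty ⊕ Fin k)) : ℕ := val (M := Herb) v t

/-! ### Definability of syntactic predicates -/

theorem primrec_hS : Primrec hS :=
  Primrec.nat_add.comp (Primrec.nat_mul.comp (.const 4) .id) (.const 1)

theorem primrec_hA : Primrec₂ hA :=
  Primrec.nat_add.comp (Primrec.nat_mul.comp (.const 4) Primrec₂.natPair) (.const 2)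

theorem primrec_hM : Primrec₂ hM :=
  Primrec.nat_add.comp (Primrec.nat_mul.comp (.const 4) Primrec₂.natPair) (.const 3)

theorem primrec_hW : Primrec hW :=
  Primrec.nat_add.comp (Primrec.nat_mul.comp (.const 4) .id) (.const 4)

theorem primrec_hNum : Primrec hNum :=
  (Primrec.nat_rec₁ 0 (primrec_hS.comp₂ .right)).of_eq fun m => by
    induction m with
    | zero => rfl
    | succ m ih => exact congrArg hS ih

/-- `p` consists of an assignment, the code of a term and its value. -/
def EvalCode (p : List ℕ × List ℕ × ℕ) : Prop :=
  ∃ (k : ℕ) (v : Fin k → ℕ) (t : LA.Term (Empty ⊕ Fin k)), p = (List.ofFn v, tcode t, hval v t)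

/-- `p` consists of a context and the code of a formula in it. -/
def FormCode (p : ℕ × List ℕ) : Prop :=
  ∃ (k : ℕ) (φ : LA.BoundedFormula Empty k), p = (k, code φ)

theorem evalCode_iff_closure (p : List ℕ × List ℕ × ℕ) : EvalCode p ↔
    Closure (fun p : List ℕ × List ℕ × ℕ =>
        (∃ i, p.2.1 = [4 * i + 2] ∧ p.1[i]? = some p.2.2) ∨ p.2 = ([1], 0))
      (fun z y y' => (z.1 = y.1 ∧ z.1 = y'.1) ∧ (z.2 = (3 :: y.2.1, hS y.2.2) ∨
        z.2 = (5 :: (y.2.1 ++ y'.2.1), hA y.2.2 y'.2.2) ∨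
        z.2 = (7 :: (y.2.1 ++ y'.2.1), hM y.2.2 y'.2.2))) p := by
  constructor
  · rintro ⟨k, v, t, rfl⟩
    induction t with
    | var i =>
      obtain i | i := i
      · exact i.elim
      · exact .base (.inl ⟨i, tcode_var i, by simp [hval, val]; rfl⟩)
    | func f ts ih =>
      cases f with
      | zero => exact .base (.inr (Prod.ext (tcode_zero ts) rfl))
      | succ =>
        refine .step ?_ (ih 0) (ih 0)
        exact ⟨⟨rfl, rfl⟩, .inl (Prod.ext (tcode_succ ts) rfl)⟩
      | add =>
        refine .step ?_ (ih 0) (ih 1)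
        exact ⟨⟨rfl, rfl⟩, .inr (.inl (Prod.ext (tcode_add ts) rfl))⟩
      | mul =>
        refine .step ?_ (ih 0) (ih 1)
        exact ⟨⟨rfl, rfl⟩, .inr (.inr (Prod.ext (tcode_mul ts) rfl))⟩
  · intro h
    induction h with
    | @base z h =>
      obtain ⟨l, x, a⟩ := z
      obtain ⟨⟨k, v⟩, rfl⟩ := List.equivSigmaTuple.symm.surjective l
      obtain ⟨i, hx, ha⟩ | hx := h
      · obtain ⟨hi, ha⟩ := List.getElem?_eq_some_iff.1 ha
        have hi' : i < k := by simpa using hi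
        refine ⟨k, v, Term.var (Sum.inr ⟨i, hi'⟩), Prod.ext rfl
          (Prod.ext (hx.trans (tcode_var ⟨i, hi'⟩).symm) (ha.symm.trans ?_))⟩
        simp [hval, val]
        rfl
      · cases hx
        exact ⟨k, v, Term.func ArithFunc.zero ![], rfl⟩
    | @step z y y' h _ _ ih ih' =>
      obtain ⟨k, v, t, rfl⟩ := ih
      obtain ⟨k', v', s, rfl⟩ := ih'
      obtain ⟨l, x, a⟩ := z
      obtain ⟨⟨h₁, h₂⟩, h⟩ := h
      dsimp only at h₁ h₂
      subst h₁
      cases List.ofFn_inj'.1 h₂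
      obtain h | h | h := h <;> cases h
      · exact ⟨k, v, Term.func ArithFunc.succ ![t], by rw [tcode_succ]; rfl⟩
      · exact ⟨k, v, Term.func ArithFunc.add ![t, s], by rw [tcode_add]; rfl⟩
      · exact ⟨k, v, Term.func ArithFunc.mul ![t, s], by rw [tcode_mul]; rfl⟩

theorem formCode_iff_closure (p : ℕ × List ℕ) : FormCode p ↔
    Closure (fun p : ℕ × List ℕ => p.2 = [4 * p.1 + 11] ∨
        ∃ q : List ℕ × (List ℕ × ℕ) × (List ℕ × ℕ),
          (EvalCode (q.1, q.2.1) ∧ EvalCode (q.1, q.2.2)) ∧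
          (p = (q.1.length, [termSym q.1.length q.2.1.1, termSym q.1.length q.2.2.1]) ∨
            p = (q.1.length, [1, 4 * q.1.length + 3, termSym q.1.length q.2.1.1,
              termSym q.1.length q.2.2.1])))
      (fun z y y' => (z.1 = y.1 ∧ z.1 = y'.1 ∧ z.2 = 3 :: (y.2 ++ y'.2)) ∨
        (z.1 + 1 = y.1 ∧ z.2 = 7 :: y.2)) p := by
  constructor
  · rintro ⟨k, φ, rfl⟩
    induction φ with
    | falsum => exact .base (.inl code_falsum)
    | @equal k t s =>
      refine .base (.inr ⟨(List.ofFn fun _ : Fin k => 0, (tcode t, _), (tcode s, _)),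
        ⟨⟨k, _, t, rfl⟩, ⟨k, _, s, rfl⟩⟩, .inl ?_⟩)
      simp [code_equal]
    | @rel k l r ts =>
      cases r
      refine .base (.inr ⟨(List.ofFn fun _ : Fin k => 0, (tcode (ts 0), _), (tcode (ts 1), _)),
        ⟨⟨k, _, ts 0, rfl⟩, ⟨k, _, ts 1, rfl⟩⟩, .inr ?_⟩)
      simp [code_rel]
    | imp φ ψ ih ih' =>
      refine .step ?_ ih ih'
      exact .inl ⟨rfl, rfl, code_imp φ ψ⟩
    | all φ ih =>
      refine .step ?_ ih ih
      exact .inr ⟨rfl, code_all φ⟩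
  · intro h
    induction h with
    | @base z h =>
      obtain ⟨k, x⟩ := z
      obtain h | ⟨⟨l, ⟨x₁, a⟩, ⟨x₂, b⟩⟩, ⟨⟨k, v, t, ht⟩, ⟨k', v', s, hs⟩⟩, h⟩ := h
      · exact ⟨k, falsum, Prod.ext rfl (h.trans code_falsum.symm)⟩
      · simp only [Prod.mk.injEq] at ht hs
        obtain ⟨rfl, rfl, rfl⟩ := ht
        obtain ⟨hs, rfl, rfl⟩ := hs
        cases List.ofFn_inj'.1 hs
        obtain h | h := h
        · exact ⟨k, .equal t s, by simpa [code_equal] using h⟩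
        · exact ⟨k, .rel ArithRel.le ![t, s], by simpa [code_rel] using h⟩
    | @step z y y' h _ _ ih ih' =>
      obtain ⟨k, φ, rfl⟩ := ih
      obtain ⟨k', ψ, rfl⟩ := ih'
      obtain ⟨m, x⟩ := z
      obtain ⟨h₁, h₂, h⟩ | ⟨h₁, h⟩ := h
      · dsimp only at h₁ h₂ h
        subst h₁ h₂ h
        exact ⟨_, φ.imp ψ, by rw [code_imp]⟩
      · dsimp only at h₁ h
        subst h₁ h
        exact ⟨_, φ.all, by rw [code_all]⟩

theorem primrec_termSym : Primrec₂ termSym :=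
  Primrec.nat_mul.comp (.const 2) (Primrec₂.natPair.comp .fst (Primrec.encode.comp .snd))

theorem sg_evalCode (n : ℕ) : Sg n EvalCode := by
  refine .of_iff (.closure (.or ?_ ?_) (.and (.and ?_ ?_) (.or ?_ (.or ?_ ?_))))
    fun p => (evalCode_iff_closure p).symm
  · refine .ex (.and (.eq (Primrec.fst.comp (Primrec.snd.comp .fst)) ?_) (.eq ?_ ?_))
    · exact Primrec.list_cons.comp (Primrec.nat_add.comp (Primrec.nat_mul.comp (.const 4) .snd)
        (.const 2)) (.const [])
    · exact Primrec.list_getElem?.comp (Primrec.fst.comp .fst) .snd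
    · exact Primrec.option_some.comp (Primrec.snd.comp (Primrec.snd.comp .fst))
  · exact .eq .snd (.const _)
  · exact .eq (Primrec.fst.comp .fst) (Primrec.fst.comp (Primrec.fst.comp .snd))
  · exact .eq (Primrec.fst.comp .fst) (Primrec.fst.comp (Primrec.snd.comp .snd))
  all_goals
    refine .eq (Primrec.snd.comp .fst) ?_
  · exact (Primrec.list_cons.comp (.const 3) (Primrec.fst.comp (Primrec.snd.comp
      (Primrec.fst.comp .snd)))).pair
      (primrec_hS.comp (Primrec.snd.comp (Primrec.snd.comp (Primrec.fst.comp .snd))))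
  · exact (Primrec.list_cons.comp (.const 5) (Primrec.list_append.comp
      (Primrec.fst.comp (Primrec.snd.comp (Primrec.fst.comp .snd)))
      (Primrec.fst.comp (Primrec.snd.comp (Primrec.snd.comp .snd))))).pair
      (primrec_hA.comp (Primrec.snd.comp (Primrec.snd.comp (Primrec.fst.comp .snd)))
        (Primrec.snd.comp (Primrec.snd.comp (Primrec.snd.comp .snd))))
  · exact (Primrec.list_cons.comp (.const 7) (Primrec.list_append.comp
      (Primrec.fst.comp (Primrec.snd.comp (Primrec.fst.comp .snd)))
      (Primrec.fst.comp (Primrec.snd.comp (Primrec.snd.comp .snd))))).pair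
      (primrec_hM.comp (Primrec.snd.comp (Primrec.snd.comp (Primrec.fst.comp .snd)))
        (Primrec.snd.comp (Primrec.snd.comp (Primrec.snd.comp .snd))))

theorem sg_formCode (n : ℕ) : Sg n FormCode := by
  have hlen : Primrec fun r : (ℕ × List ℕ) × (List ℕ × (List ℕ × ℕ) × (List ℕ × ℕ)) =>
      r.2.1.length := Primrec.list_length.comp (Primrec.fst.comp .snd)
  have hx : Primrec fun r : (ℕ × List ℕ) × (List ℕ × (List ℕ × ℕ) × (List ℕ × ℕ)) =>
      termSym r.2.1.length r.2.2.1.1 :=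
    primrec_termSym.comp hlen (Primrec.fst.comp (Primrec.fst.comp (Primrec.snd.comp .snd)))
  have hy : Primrec fun r : (ℕ × List ℕ) × (List ℕ × (List ℕ × ℕ) × (List ℕ × ℕ)) =>
      termSym r.2.1.length r.2.2.2.1 :=
    primrec_termSym.comp hlen (Primrec.fst.comp (Primrec.snd.comp (Primrec.snd.comp .snd)))
  have hxy := Primrec.list_cons.comp hx (Primrec.list_cons.comp hy (.const []))
  refine .of_iff (.closure (.or ?_ (.ex (.and (.and ?_ ?_) (.or ?_ ?_))))
    (.or (.and ?_ (.and ?_ ?_)) (.and ?_ ?_))) fun p => (formCode_iff_closure p).symm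
  · exact .eq .snd (Primrec.list_cons.comp (Primrec.nat_add.comp (Primrec.nat_mul.comp (.const 4)
      .fst) (.const 11)) (.const []))
  · exact (sg_evalCode n).comp ((Primrec.fst.comp .snd).pair
      (Primrec.fst.comp (Primrec.snd.comp .snd)))
  · exact (sg_evalCode n).comp ((Primrec.fst.comp .snd).pair
      (Primrec.snd.comp (Primrec.snd.comp .snd)))
  · exact .eq .fst (hlen.pair hxy)
  · exact .eq .fst (hlen.pair (Primrec.list_cons.comp (.const 1) (Primrec.list_cons.comp
      (Primrec.nat_add.comp (Primrec.nat_mul.comp (.const 4) hlen) (.const 3)) hxy)))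
  · exact .eq (Primrec.fst.comp .fst) (Primrec.fst.comp (Primrec.fst.comp .snd))
  · exact .eq (Primrec.fst.comp .fst) (Primrec.fst.comp (Primrec.snd.comp .snd))
  · exact .eq (Primrec.snd.comp .fst) (Primrec.list_cons.comp (.const 3)
      (Primrec.list_append.comp (Primrec.snd.comp (Primrec.fst.comp .snd))
        (Primrec.snd.comp (Primrec.snd.comp .snd))))
  · exact .eq (Primrec.succ.comp (Primrec.fst.comp .fst)) (Primrec.fst.comp (Primrec.fst.comp .snd))
  · exact .eq (Primrec.snd.comp .fst) (Primrec.list_cons.comp (.const 7)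
      (Primrec.snd.comp (Primrec.fst.comp .snd)))

/-! ### Propositional clauses describing models of a theory -/

/-- The propositional variable for the formula with code `l` under the assignment `v`. -/
def atom (l v : List ℕ) : ℕ := Nat.pair (Encodable.encode l) (Encodable.encode v)

/-- The propositional variable for the formula `φ` under the assignment `v`. -/
def idx {k : ℕ} (φ : LA.BoundedFormula Empty k) (v : Fin k → ℕ) : ℕ := atom (code φ) (List.ofFn v)

/-- The propositional variable for the equality of two closed Henkin terms. -/
def eqAt (a b : ℕ) : ℕ :=
  idx (BoundedFormula.equal (&0) (&1) : LA.BoundedFormula Empty 2) ![a, b]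

/-- The propositional variable for the inequality between two closed Henkin terms. -/
def leAt (a b : ℕ) : ℕ := idx (leF (&0) (&1) : LA.BoundedFormula Empty 2) ![a, b]

/-- Clauses expressing that a propositional valuation describes a model of `T` whose elements are
denoted by closed Henkin terms. A clause is the list of literals which are not allowed to hold
simultaneously. -/
inductive Clause (T : LA.Theory) : List (ℕ × Bool) → Prop
  | falsum {k : ℕ} (v : Fin k → ℕ) : Clause T [(idx falsum v, true)]
  | imp {k : ℕ} (φ ψ : LA.BoundedFormula Empty k) (v : Fin k → ℕ) :
      Clause T [(idx (φ.imp ψ) v, true), (idx φ v, true), (idx ψ v, false)]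
  | imp_left {k : ℕ} (φ ψ : LA.BoundedFormula Empty k) (v : Fin k → ℕ) :
      Clause T [(idx (φ.imp ψ) v, false), (idx φ v, false)]
  | imp_right {k : ℕ} (φ ψ : LA.BoundedFormula Empty k) (v : Fin k → ℕ) :
      Clause T [(idx (φ.imp ψ) v, false), (idx ψ v, true)]
  | all {k : ℕ} (φ : LA.BoundedFormula Empty (k + 1)) (v : Fin k → ℕ) (a : ℕ) :
      Clause T [(idx φ.all v, true), (idx φ (Fin.snoc v a), false)]
  | henkin {k : ℕ} (φ : LA.BoundedFormula Empty (k + 1)) (v : Fin k → ℕ) :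
      Clause T [(idx φ.all v, false), (idx φ (Fin.snoc v (hW (idx φ.all v))), true)]
  | equal {k : ℕ} (t s : LA.Term (Empty ⊕ Fin k)) (v : Fin k → ℕ) (b : Bool) :
      Clause T [(idx (.equal t s) v, b), (eqAt (hval v t) (hval v s), !b)]
  | le {k : ℕ} (t s : LA.Term (Empty ⊕ Fin k)) (v : Fin k → ℕ) (b : Bool) :
      Clause T [(idx (leF t s) v, b), (leAt (hval v t) (hval v s), !b)]
  | refl (a : ℕ) : Clause T [(eqAt a a, false)]
  | euclid (a b c : ℕ) : Clause T [(eqAt a b, true), (eqAt a c, true), (eqAt b c, false)]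
  | succ_congr (a b : ℕ) : Clause T [(eqAt a b, true), (eqAt (hS a) (hS b), false)]
  | add_congr (a b c d : ℕ) :
      Clause T [(eqAt a b, true), (eqAt c d, true), (eqAt (hA a c) (hA b d), false)]
  | mul_congr (a b c d : ℕ) :
      Clause T [(eqAt a b, true), (eqAt c d, true), (eqAt (hM a c) (hM b d), false)]
  | le_congr (a b c d : ℕ) :
      Clause T [(eqAt a b, true), (eqAt c d, true), (leAt a c, true), (leAt b d, false)]
  | axm (φ : LA.Sentence) : φ ∈ T → Clause T [(idx φ ![], false)]

theorem primrec_atom : Primrec₂ atom :=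
  Primrec₂.natPair.comp (Primrec.encode.comp .fst) (Primrec.encode.comp .snd)

theorem primrec_eqAt : Primrec₂ eqAt :=
  primrec_atom.comp (.const _) (Primrec.list_cons.comp .fst
    (Primrec.list_cons.comp .snd (.const [])))

theorem primrec_leAt : Primrec₂ leAt :=
  primrec_atom.comp (.const _) (Primrec.list_cons.comp .fst
    (Primrec.list_cons.comp .snd (.const [])))

theorem ofFn_snoc {k : ℕ} (v : Fin k → ℕ) (a : ℕ) :
    List.ofFn (Fin.snoc v a : Fin (k + 1) → ℕ) = List.ofFn v ++ [a] := by
  rw [List.ofFn_succ']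
  simp

theorem Sg.image {n : ℕ} {γ δ : Type} [Primcodable γ] [Primcodable δ] {P : γ → Prop} {f : γ → δ}
    (hP : Sg n P) (hf : Primrec f) : Sg n fun d => ∃ c, P c ∧ d = f c :=
  .ex ((hP.comp .snd).and (.eq .fst (hf.comp .snd)))

theorem Sg.range {n : ℕ} {γ δ : Type} [Primcodable γ] [Primcodable δ] {f : γ → δ}
    (hf : Primrec f) : Sg n fun d => ∃ c, d = f c :=
  .ex (.eq .fst (hf.comp .snd))

section literals

variable {γ : Type} [Primcodable γ] {f g h : γ → ℕ}

theorem primrec_clause₁ (hf : Primrec f) (b : Bool) : Primrec fun c => [(f c, b)] :=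
  Primrec.list_cons.comp (hf.pair (.const b)) (.const [])

theorem primrec_clause₂ (hf : Primrec f) (hg : Primrec g) (b b' : Bool) :
    Primrec fun c => [(f c, b), (g c, b')] :=
  Primrec.list_cons.comp (hf.pair (.const b)) (primrec_clause₁ hg b')

theorem primrec_clause₃ (hf : Primrec f) (hg : Primrec g) (hh : Primrec h) (b b' b'' : Bool) :
    Primrec fun c => [(f c, b), (g c, b'), (h c, b'')] :=
  Primrec.list_cons.comp (hf.pair (.const b)) (primrec_clause₂ hg hh b' b'')

end literals

theorem sg_clause_imp (n : ℕ) : Sg n fun c => ∃ (k : ℕ) (φ ψ : LA.BoundedFormula Empty k)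
    (v : Fin k → ℕ), c = [(idx (φ.imp ψ) v, true), (idx φ v, true), (idx ψ v, false)] ∨
      c = [(idx (φ.imp ψ) v, false), (idx φ v, false)] ∨
      c = [(idx (φ.imp ψ) v, false), (idx ψ v, true)] := by
  have hl : Primrec fun p : List (ℕ × Bool) × (List ℕ × List ℕ × List ℕ) => p.2.2.1 :=
    Primrec.fst.comp (Primrec.snd.comp .snd)
  have hr : Primrec fun p : List (ℕ × Bool) × (List ℕ × List ℕ × List ℕ) => p.2.2.2 :=
    Primrec.snd.comp (Primrec.snd.comp .snd)
  have hv : Primrec fun p : List (ℕ × Bool) × (List ℕ × List ℕ × List ℕ) => p.2.1 :=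
    Primrec.fst.comp .snd
  have hi := primrec_atom.comp
    (Primrec.list_cons.comp (.const 3) (Primrec.list_append.comp hl hr)) hv
  have hl' := primrec_atom.comp hl hv
  have hr' := primrec_atom.comp hr hv
  refine .of_iff (.exists_snd (.and (.and
    ((sg_formCode n).comp ((Primrec.list_length.comp hv).pair hl))
    ((sg_formCode n).comp ((Primrec.list_length.comp hv).pair hr)))
    (.or (.eq .fst (primrec_clause₃ hi hl' hr' true true false))
    (.or (.eq .fst (primrec_clause₂ hi hl' false false))
    (.eq .fst (primrec_clause₂ hi hr' false true)))))) fun c => ?_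
  constructor
  · rintro ⟨⟨v, l, r⟩, ⟨⟨k, φ, hφ⟩, ⟨k', ψ, hψ⟩⟩, h⟩
    obtain ⟨⟨m, v⟩, rfl⟩ := List.equivSigmaTuple.symm.surjective v
    simp only [List.equivSigmaTuple_symm_apply, List.length_ofFn, Prod.mk.injEq] at hφ hψ h
    obtain ⟨rfl, rfl⟩ := hφ
    obtain ⟨rfl, rfl⟩ := hψ
    exact ⟨m, φ, ψ, v, by simpa only [idx, code_imp] using h⟩
  · rintro ⟨k, φ, ψ, v, h⟩
    exact ⟨(List.ofFn v, code φ, code ψ), ⟨⟨k, φ, by simp⟩, ⟨k, ψ, by simp⟩⟩,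
      by simpa only [idx, code_imp] using h⟩

theorem sg_clause_all (n : ℕ) : Sg n fun c => ∃ (k : ℕ) (φ : LA.BoundedFormula Empty (k + 1))
    (v : Fin k → ℕ) (a : ℕ), c = [(idx φ.all v, true), (idx φ (Fin.snoc v a), false)] ∨
      c = [(idx φ.all v, false), (idx φ (Fin.snoc v (hW (idx φ.all v))), true)] := by
  have hl : Primrec fun p : List (ℕ × Bool) × (List ℕ × List ℕ × ℕ) => p.2.2.1 :=
    Primrec.fst.comp (Primrec.snd.comp .snd)
  have ha : Primrec fun p : List (ℕ × Bool) × (List ℕ × List ℕ × ℕ) => p.2.2.2 :=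
    Primrec.snd.comp (Primrec.snd.comp .snd)
  have hv : Primrec fun p : List (ℕ × Bool) × (List ℕ × List ℕ × ℕ) => p.2.1 :=
    Primrec.fst.comp .snd
  have hi := primrec_atom.comp (Primrec.list_cons.comp (.const 7) hl) hv
  have happ : ∀ {f : List (ℕ × Bool) × (List ℕ × List ℕ × ℕ) → ℕ}, Primrec f →
      Primrec fun p => atom p.2.2.1 (p.2.1 ++ [f p]) := fun hf =>
    primrec_atom.comp hl (Primrec.list_append.comp hv (Primrec.list_cons.comp hf (.const [])))
  refine .of_iff (.exists_snd (.and ((sg_formCode n).comp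
    ((Primrec.succ.comp (Primrec.list_length.comp hv)).pair hl))
    (.or (.eq .fst (primrec_clause₂ hi (happ ha) true false))
    (.eq .fst (primrec_clause₂ hi (happ (primrec_hW.comp hi)) false true))))) fun c => ?_
  constructor
  · rintro ⟨⟨v, l, a⟩, ⟨k, φ, hφ⟩, h⟩
    obtain ⟨⟨m, v⟩, rfl⟩ := List.equivSigmaTuple.symm.surjective v
    simp only [List.equivSigmaTuple_symm_apply, List.length_ofFn, Prod.mk.injEq] at hφ h
    obtain ⟨rfl, rfl⟩ := hφ
    exact ⟨m, φ, v, a, by simpa only [idx, ofFn_snoc, code_all] using h⟩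
  · rintro ⟨k, φ, v, a, h⟩
    exact ⟨(List.ofFn v, code φ, a), ⟨_, φ, by simp⟩,
      by simpa only [idx, ofFn_snoc, code_all] using h⟩

theorem sg_clause_atomic (n : ℕ) : Sg n fun c => ∃ (k : ℕ) (t s : LA.Term (Empty ⊕ Fin k))
    (v : Fin k → ℕ) (b : Bool), c = [(idx (.equal t s) v, b), (eqAt (hval v t) (hval v s), !b)] ∨
      c = [(idx (leF t s) v, b), (leAt (hval v t) (hval v s), !b)] := by
  let γ := List (ℕ × Bool) × ((List ℕ × (List ℕ × ℕ) × (List ℕ × ℕ)) × Bool)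
  have hv : Primrec fun p : γ => p.2.1.1 := Primrec.fst.comp (Primrec.fst.comp .snd)
  have ht : Primrec fun p : γ => p.2.1.2.1 :=
    Primrec.fst.comp (Primrec.snd.comp (Primrec.fst.comp .snd))
  have hs : Primrec fun p : γ => p.2.1.2.2 :=
    Primrec.snd.comp (Primrec.snd.comp (Primrec.fst.comp .snd))
  have hb : Primrec fun p : γ => p.2.2 := Primrec.snd.comp .snd
  have hb' : Primrec fun p : γ => !p.2.2 := Primrec.not.comp hb
  have hlen := Primrec.list_length.comp hv
  have hx := primrec_termSym.comp hlen (Primrec.fst.comp ht)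
  have hy := primrec_termSym.comp hlen (Primrec.fst.comp hs)
  have hxy := Primrec.list_cons.comp hx (Primrec.list_cons.comp hy (.const []))
  have hxy' := Primrec.list_cons.comp (.const 1) (Primrec.list_cons.comp
      (Primrec.nat_add.comp (Primrec.nat_mul.comp (.const 4) hlen) (.const 3)) hxy)
  have he := primrec_eqAt.comp (Primrec.snd.comp ht) (Primrec.snd.comp hs)
  have hle := primrec_leAt.comp (Primrec.snd.comp ht) (Primrec.snd.comp hs)
  refine .of_iff (.exists_snd (.and (.and ((sg_evalCode n).comp (hv.pair ht))
    ((sg_evalCode n).comp (hv.pair hs)))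
    (.or (.eq .fst (Primrec.list_cons.comp ((primrec_atom.comp hxy hv).pair hb)
      (Primrec.list_cons.comp (he.pair hb') (.const []))))
    (.eq .fst (Primrec.list_cons.comp ((primrec_atom.comp hxy' hv).pair hb)
      (Primrec.list_cons.comp (hle.pair hb') (.const []))))))) fun c => ?_
  constructor
  · rintro ⟨⟨⟨v, ⟨x, a⟩, ⟨y, b⟩⟩, d⟩, ⟨⟨k, v, t, ht⟩, ⟨k', v', s, hs⟩⟩, h⟩
    simp only [Prod.mk.injEq] at ht hs h
    obtain ⟨rfl, rfl, rfl⟩ := ht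
    obtain ⟨hs, rfl, rfl⟩ := hs
    cases List.ofFn_inj'.1 hs
    rw [List.length_ofFn] at h
    exact ⟨k, t, s, v, d, by simpa only [idx, code_equal, code_leF] using h⟩
  · rintro ⟨k, t, s, v, b, h⟩
    refine ⟨⟨⟨List.ofFn v, ⟨tcode t, hval v t⟩, ⟨tcode s, hval v s⟩⟩, b⟩,
      ⟨⟨k, v, t, rfl⟩, ⟨k, v, s, rfl⟩⟩, ?_⟩
    rw [List.length_ofFn]
    simpa only [idx, code_equal, code_leF] using h

theorem sg_clause_congr (n : ℕ) : Sg n fun c => ∃ p : (ℕ × ℕ) × ℕ × ℕ,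
    c = [(eqAt p.1.1 p.1.1, false)] ∨
    c = [(eqAt p.1.1 p.1.2, true), (eqAt p.1.1 p.2.1, true), (eqAt p.1.2 p.2.1, false)] ∨
    c = [(eqAt p.1.1 p.1.2, true), (eqAt (hS p.1.1) (hS p.1.2), false)] ∨
    c = [(eqAt p.1.1 p.1.2, true), (eqAt p.2.1 p.2.2, true),
      (eqAt (hA p.1.1 p.2.1) (hA p.1.2 p.2.2), false)] ∨
    c = [(eqAt p.1.1 p.1.2, true), (eqAt p.2.1 p.2.2, true),
      (eqAt (hM p.1.1 p.2.1) (hM p.1.2 p.2.2), false)] ∨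
    c = [(eqAt p.1.1 p.1.2, true), (eqAt p.2.1 p.2.2, true), (leAt p.1.1 p.2.1, true),
      (leAt p.1.2 p.2.2, false)] := by
  let γ := List (ℕ × Bool) × ((ℕ × ℕ) × ℕ × ℕ)
  have ha : Primrec fun p : γ => p.2.1.1 := Primrec.fst.comp (Primrec.fst.comp .snd)
  have hb : Primrec fun p : γ => p.2.1.2 := Primrec.snd.comp (Primrec.fst.comp .snd)
  have hc : Primrec fun p : γ => p.2.2.1 := Primrec.fst.comp (Primrec.snd.comp .snd)
  have hd : Primrec fun p : γ => p.2.2.2 := Primrec.snd.comp (Primrec.snd.comp .snd)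
  have hab := primrec_eqAt.comp ha hb
  have hcd := primrec_eqAt.comp hc hd
  exact .ex (.or (.eq .fst (primrec_clause₁ (primrec_eqAt.comp ha ha) false))
    (.or (.eq .fst (primrec_clause₃ hab (primrec_eqAt.comp ha hc) (primrec_eqAt.comp hb hc)
      true true false))
    (.or (.eq .fst (primrec_clause₂ hab (primrec_eqAt.comp (primrec_hS.comp ha)
      (primrec_hS.comp hb)) true false))
    (.or (.eq .fst (primrec_clause₃ hab hcd (primrec_eqAt.comp (primrec_hA.comp ha hc)
      (primrec_hA.comp hb hd)) true true false))
    (.or (.eq .fst (primrec_clause₃ hab hcd (primrec_eqAt.comp (primrec_hM.comp ha hc)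
      (primrec_hM.comp hb hd)) true true false))
    (.eq .fst (Primrec.list_cons.comp (hab.pair (.const true)) (primrec_clause₃ hcd
      (primrec_leAt.comp ha hc) (primrec_leAt.comp hb hd) true true false))))))))

theorem sg_clause {n : ℕ} {T : LA.Theory} (hT : SgN n fun m => m ∈ axiomCodes T) :
    Sg n (Clause T) := by
  have hbot : Primrec fun v : List ℕ => [(atom [4 * v.length + 11] v, true)] :=
    primrec_clause₁ (primrec_atom.comp (Primrec.list_cons.comp (Primrec.nat_add.comp
      (Primrec.nat_mul.comp (.const 4) Primrec.list_length) (.const 11)) (.const [])) .id) true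
  have haxm : Primrec fun m : ℕ => [(Nat.pair m (Encodable.encode ([] : List ℕ)), false)] :=
    primrec_clause₁ (Primrec₂.natPair.comp .id (.const _)) false
  have hidx : ∀ φ : LA.Sentence, idx φ ![] =
      Nat.pair (godel φ) (Encodable.encode ([] : List ℕ)) := fun φ => by
    rw [idx, atom, encode_code]
    rfl
  refine .of_iff (.or (Sg.range hbot) (.or (sg_clause_imp n) (.or (sg_clause_all n)
    (.or (sg_clause_atomic n) (.or (sg_clause_congr n) (.image (Sg.of_sgN hT) haxm))))))
    fun c => ?_
  constructor
  · rintro (⟨v, rfl⟩ | ⟨k, φ, ψ, v, rfl | rfl | rfl⟩ | ⟨k, φ, v, a, rfl | rfl⟩ |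
      ⟨k, t, s, v, b, rfl | rfl⟩ | ⟨⟨⟨a, b⟩, c, d⟩, rfl | rfl | rfl | rfl | rfl | rfl⟩ |
      ⟨m, ⟨φ, hφ, rfl⟩, rfl⟩)
    · have h := Clause.falsum (T := T) v.get
      rwa [idx, code_falsum, List.ofFn_get] at h
    · exact .imp φ ψ v
    · exact .imp_left φ ψ v
    · exact .imp_right φ ψ v
    · exact .all φ v a
    · exact .henkin φ v
    · exact .equal t s v b
    · exact .le t s v b
    · exact .refl a
    · exact .euclid a b c
    · exact .succ_congr a b
    · exact .add_congr a b c d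
    · exact .mul_congr a b c d
    · exact .le_congr a b c d
    · exact hidx φ ▸ .axm φ hφ
  · intro h
    cases h with
    | falsum v => exact .inl ⟨List.ofFn v, by rw [idx, code_falsum, List.length_ofFn]⟩
    | imp φ ψ v => exact .inr (.inl ⟨_, φ, ψ, v, .inl rfl⟩)
    | imp_left φ ψ v => exact .inr (.inl ⟨_, φ, ψ, v, .inr (.inl rfl)⟩)
    | imp_right φ ψ v => exact .inr (.inl ⟨_, φ, ψ, v, .inr (.inr rfl)⟩)
    | all φ v a => exact .inr (.inr (.inl ⟨_, φ, v, a, .inl rfl⟩))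
    | henkin φ v => exact .inr (.inr (.inl ⟨_, φ, v, 0, .inr rfl⟩))
    | equal t s v b => exact .inr (.inr (.inr (.inl ⟨_, t, s, v, b, .inl rfl⟩)))
    | le t s v b => exact .inr (.inr (.inr (.inl ⟨_, t, s, v, b, .inr rfl⟩)))
    | refl a => exact .inr (.inr (.inr (.inr (.inl ⟨((a, 0), 0, 0), .inl rfl⟩))))
    | euclid a b c =>
      exact .inr (.inr (.inr (.inr (.inl ⟨((a, b), c, 0), .inr (.inl rfl)⟩))))
    | succ_congr a b =>
      exact .inr (.inr (.inr (.inr (.inl ⟨((a, b), 0, 0), .inr (.inr (.inl rfl))⟩))))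
    | add_congr a b c d =>
      exact .inr (.inr (.inr (.inr (.inl ⟨((a, b), c, d), .inr (.inr (.inr (.inl rfl)))⟩))))
    | mul_congr a b c d =>
      exact .inr (.inr (.inr (.inr (.inl ⟨((a, b), c, d), .inr (.inr (.inr (.inr (.inl rfl))))⟩))))
    | le_congr a b c d =>
      exact .inr (.inr (.inr (.inr (.inl ⟨((a, b), c, d), .inr (.inr (.inr (.inr (.inr rfl))))⟩))))
    | axm φ hφ =>
      exact .inr (.inr (.inr (.inr (.inr ⟨godel φ, ⟨φ, hφ, rfl⟩, by rw [hidx]⟩))))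

/-! ### Compactness of propositional logic -/

/-- The valuation `V` violates no clause of `K`. -/
def Avoids (K : List (ℕ × Bool) → Prop) (V : ℕ → Bool) : Prop :=
  ∀ c, K c → ¬ ∀ q ∈ c, V q.1 = q.2

theorem exists_avoids_iff (K : List (ℕ × Bool) → Prop) : (∃ V, Avoids K V) ↔
    ∀ N, ∃ b < 2 ^ N, ∀ c, K c → ¬ ∀ q ∈ c, q.1 < N ∧ b.testBit q.1 = q.2 := by
  constructor
  · rintro ⟨V, hV⟩ N
    refine ⟨Nat.ofBits fun i : Fin N => V i, Nat.ofBits_lt_two_pow _, fun c hc h => ?_⟩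
    refine hV c hc fun q hq => ?_
    obtain ⟨hN, hb⟩ := h q hq
    rw [← hb, Nat.testBit_ofBits_lt _ _ hN]
  · intro h
    choose b _ hb using h
    classical
    refine ⟨fun i => decide (∀ᶠ N in (Filter.hyperfilter ℕ : Filter ℕ), (b N).testBit i),
      fun c hc h => ?_⟩
    have hev : ∀ q ∈ c, ∀ᶠ N in (Filter.hyperfilter ℕ : Filter ℕ),
        q.1 < N ∧ (b N).testBit q.1 = q.2 := by
      intro q hq
      have hlt : ∀ᶠ N in (Filter.hyperfilter ℕ : Filter ℕ), q.1 < N :=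
        (Nat.hyperfilter_le_atTop : _) (Filter.eventually_gt_atTop q.1)
      refine hlt.and ?_
      have hq' := h q hq
      cases hs : q.2 with
      | true => simpa [hs] using hq'
      | false =>
        rw [hs] at hq'
        simpa [← Ultrafilter.eventually_not] using hq'
    have hall : ∀ᶠ N in (Filter.hyperfilter ℕ : Filter ℕ),
        ∀ q ∈ c, q.1 < N ∧ (b N).testBit q.1 = q.2 := by
      clear hc h
      induction c with
      | nil => simp
      | cons q c ih =>
        simp only [List.forall_mem_cons] at hev ⊢
        exact hev.1.and (ih hev.2)
    obtain ⟨N, hN⟩ := hall.exists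
    exact hb N c hc hN

theorem primrec_two_pow : Primrec fun N : ℕ => 2 ^ N :=
  (Primrec.nat_rec₁ 1 (Primrec.nat_mul.comp₂ .right (.const 2))).of_eq fun m => by
    induction m with
    | zero => rfl
    | succ m ih => rw [Nat.pow_succ, ← ih]

theorem primrec_testBit : Primrec₂ Nat.testBit := by
  refine (Primrec.beq.comp (Primrec.nat_mod.comp (Primrec.nat_div.comp .fst
    (primrec_two_pow.comp .snd)) (.const 2)) (.const 1)).of_eq fun p => ?_
  rw [Nat.testBit_eq_decide_div_mod_eq]
  rfl

/-- Unsatisfiability of a `Σ_{n+1}`-set of clauses together with a literal is `Σ_{n+1}`. -/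
theorem sg_not_exists_avoids {n : ℕ} {K : List (ℕ × Bool) → Prop} (hK : Sg n K) :
    Sg n fun p : ℕ × Bool => ¬ ∃ V, Avoids K V ∧ V p.1 = p.2 := by
  have hK' : Sg n fun p : List (ℕ × Bool) × ℕ × Bool => K p.1 ∨ p.1 = [(p.2.1, !p.2.2)] :=
    .or (hK.comp .fst) (.eq .fst (Primrec.list_cons.comp ((Primrec.fst.comp .snd).pair
      (Primrec.not.comp (Primrec.snd.comp .snd))) (.const [])))
  let γ := ((((ℕ × Bool) × ℕ) × ℕ) × List (ℕ × Bool)) × ℕ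
  have hmem : Sg n fun p : (((ℕ × Bool) × ℕ) × ℕ) × List (ℕ × Bool) =>
      ∀ i < p.2.length, ∃ q, p.2[i]? = some q ∧ q.1 < p.1.1.2 ∧ p.1.2.testBit q.1 = q.2 := by
    refine .ball (R := fun (p : (((ℕ × Bool) × ℕ) × ℕ) × List (ℕ × Bool)) i => ∃ q : ℕ × Bool,
      p.2[i]? = some q ∧ q.1 < p.1.1.2 ∧ p.1.2.testBit q.1 = q.2)
      (.exists_snd (P := fun r : γ × ℕ × Bool => r.1.1.2[r.1.2]? = some r.2 ∧
        r.2.1 < r.1.1.1.1.2 ∧ r.1.1.1.2.testBit r.2.1 = r.2.2)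
      (.and (.eq ?_ ?_) (.and (.lt ?_ ?_) (.eq ?_ ?_)))) (Primrec.list_length.comp .snd)
    · exact Primrec.list_getElem?.comp (Primrec.snd.comp (Primrec.fst.comp .fst))
        (Primrec.snd.comp .fst)
    · exact Primrec.option_some.comp .snd
    · exact Primrec.fst.comp .snd
    · exact Primrec.snd.comp (Primrec.fst.comp (Primrec.fst.comp (Primrec.fst.comp .fst)))
    · exact primrec_testBit.comp (Primrec.snd.comp (Primrec.fst.comp (Primrec.fst.comp .fst)))
        (Primrec.fst.comp .snd)
    · exact Primrec.snd.comp .snd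
  have hbad : Sg n fun p : ((ℕ × Bool) × ℕ) × ℕ =>
      ∃ l : List (ℕ × Bool), (K l ∨ l = [(p.1.1.1, !p.1.1.2)]) ∧
      ∀ i < l.length, ∃ q, l[i]? = some q ∧ q.1 < p.1.2 ∧ p.2.testBit q.1 = q.2 :=
    .exists_snd (.and (hK'.comp (Primrec.snd.pair (Primrec.fst.comp
      (Primrec.fst.comp .fst)))) hmem)
  refine .of_iff (.exists_snd (.ball (R := fun (p : (ℕ × Bool) × ℕ) b =>
    ∃ l : List (ℕ × Bool), (K l ∨ l = [(p.1.1, !p.1.2)]) ∧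
      ∀ i < l.length, ∃ q, l[i]? = some q ∧ q.1 < p.2 ∧ b.testBit q.1 = q.2) hbad
      (primrec_two_pow.comp .snd))) fun p => ?_
  have h := exists_avoids_iff fun c => K c ∨ c = [(p.1, !p.2)]
  have hl : (∃ V, Avoids (fun c => K c ∨ c = [(p.1, !p.2)]) V) ↔ ∃ V, Avoids K V ∧ V p.1 = p.2 := by
    refine exists_congr fun V => ⟨fun h => ⟨fun c hc => h c (.inl hc), ?_⟩, fun h c hc => ?_⟩
    · simpa using h _ (.inr rfl)
    · obtain hc | rfl := hc
      · exact h.1 c hc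
      · simpa using h.2
  rw [← hl, h]
  push Not
  refine exists_congr fun N => forall₂_congr fun b _ => exists_congr fun l =>
    and_congr_right fun _ => ⟨fun h q hq => ?_, fun h i hi => ?_⟩
  · obtain ⟨i, hi⟩ := List.mem_iff_getElem?.1 hq
    obtain ⟨q', hq', h⟩ := h i (List.getElem?_eq_some_iff.1 hi).1
    obtain rfl : q = q' := by simpa [hi] using hq'
    exact h
  · exact ⟨l[i], by simp [hi], h _ (List.getElem_mem hi)⟩

/-! ### The Henkin model of a valuation -/

section Henkin

variable {T : LA.Theory} {V : ℕ → Bool}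

/-- Two closed Henkin terms are identified if the valuation declares them equal. -/
def henkinSetoid (hV : Avoids (Clause T) V) : Setoid ℕ :=
  have euclid {a b c : ℕ} (h : V (eqAt a b) = true) (h' : V (eqAt a c) = true) :
      V (eqAt b c) = true := by
    simpa [h, h'] using hV _ (.euclid a b c)
  have refl (a : ℕ) : V (eqAt a a) = true := by simpa using hV _ (.refl a)
  ⟨fun a b => V (eqAt a b) = true, refl, fun {a b} h => euclid h (refl a),
    fun {a b c} h h' => euclid (euclid h (refl a)) h'⟩

/-- The Henkin model of a valuation. -/
def HenkinModel (hV : Avoids (Clause T) V) : Type := Quotient (henkinSetoid hV)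

/-- The element of the Henkin model denoted by a closed Henkin term. -/
def HenkinModel.mk (hV : Avoids (Clause T) V) (a : ℕ) : HenkinModel hV := Quotient.mk _ a

variable (hV : Avoids (Clause T) V)

instance : LA.Structure (HenkinModel hV) where
  funMap {_} f := match f with
    | ArithFunc.zero => fun _ => HenkinModel.mk hV 0
    | ArithFunc.succ => fun v => Quotient.map hS (fun a b h => by
        have h : V (eqAt a b) = true := h
        change V _ = true
        simpa [h] using hV _ (.succ_congr a b)) (v 0)
    | ArithFunc.add => fun v => Quotient.map₂ hA (fun a b h c d h' => by
        have h : V (eqAt a b) = true := h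
        have h' : V (eqAt c d) = true := h'
        change V _ = true
        simpa [h, h'] using hV _ (.add_congr a b c d)) (v 0) (v 1)
    | ArithFunc.mul => fun v => Quotient.map₂ hM (fun a b h c d h' => by
        have h : V (eqAt a b) = true := h
        have h' : V (eqAt c d) = true := h'
        change V _ = true
        simpa [h, h'] using hV _ (.mul_congr a b c d)) (v 0) (v 1)
  RelMap {_} r := match r with
    | ArithRel.le => fun v => Quotient.lift₂ (fun a b => V (leAt a b) = true)
        (fun a c b d h h' => by
          have h : V (eqAt a b) = true := h
          have h' : V (eqAt c d) = true := h'
          have hs := (henkinSetoid hV).symm h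
          have hs' := (henkinSetoid hV).symm h'
          have hs : V (eqAt b a) = true := hs
          have hs' : V (eqAt d c) = true := hs'
          have h₁ := hV _ (.le_congr a b c d)
          have h₂ := hV _ (.le_congr b a d c)
          simp only [List.forall_mem_cons, h, h', hs, hs'] at h₁ h₂
          apply propext
          constructor <;> intro h₃ <;> simp_all) (v 0) (v 1)

/-- The interpretation of closed Henkin terms as a homomorphism. -/
def HenkinModel.hom : Herb →[LA] HenkinModel hV where
  toFun := HenkinModel.mk hV
  map_fun' {n} f x := by cases f <;> rfl
  map_rel' r x h := h.elim

theorem HenkinModel.val_mk {k : ℕ} (v : Fin k → ℕ) (t : LA.Term (Empty ⊕ Fin k)) :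
    val (fun i => HenkinModel.mk hV (v i)) t = HenkinModel.mk hV (hval v t) := by
  refine Eq.trans ?_ (HomClass.realize_term (HenkinModel.hom hV) (t := t)
    (v := Sum.elim (default : Empty → Herb) v))
  refine congrArg (fun w => Term.realize w t) (funext fun i => ?_)
  obtain i | i := i
  · exact i.elim
  · rfl

theorem HenkinModel.sat_iff {k : ℕ} (φ : LA.BoundedFormula Empty k) (v : Fin k → ℕ) :
    Sat φ (fun i => HenkinModel.mk hV (v i)) ↔ V (idx φ v) = true := by
  induction φ with
  | falsum => exact iff_of_false id (by simpa using hV _ (.falsum v))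
  | @equal k t s =>
    have h (b : Bool) := hV _ (.equal t s v b)
    have h₁ := h true
    have h₂ := h false
    refine (sat_equal t s _).trans ?_
    rw [val_mk, val_mk]
    refine Quotient.eq.trans (show V (eqAt (hval v t) (hval v s)) = true ↔ _ from ?_)
    simp_all
  | @rel k l r ts =>
    cases r
    have hts : rel (L := LA) ArithRel.le ts = leF (ts 0) (ts 1) := by
      refine congrArg (rel (L := LA) ArithRel.le) (funext fun i => ?_)
      fin_cases i <;> rfl
    rw [hts]
    have h (b : Bool) := hV _ (.le (ts 0) (ts 1) v b)
    have h₁ := h true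
    have h₂ := h false
    refine (sat_leF (ts 0) (ts 1) _).trans ?_
    rw [val_mk, val_mk]
    refine (show V (leAt (hval v (ts 0)) (hval v (ts 1))) = true ↔ _ from ?_)
    simp_all
  | imp φ ψ ih ih' =>
    refine realize_imp.trans ?_
    have h₁ := hV _ (.imp φ ψ v)
    have h₂ := hV _ (.imp_left φ ψ v)
    have h₃ := hV _ (.imp_right φ ψ v)
    simp only [Sat] at ih ih'
    rw [ih, ih']
    simp_all
    grind
  | @all k φ ih =>
    refine realize_all.trans ?_
    have hsnoc (a : ℕ) : (Fin.snoc (fun i => HenkinModel.mk hV (v i)) (HenkinModel.mk hV a) :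
        Fin (k + 1) → HenkinModel hV) =
        fun i => HenkinModel.mk hV ((Fin.snoc v a : Fin (k + 1) → ℕ) i) :=
      (Fin.comp_snoc (HenkinModel.mk hV) v a).symm
    constructor
    · intro h
      have h₁ := (ih _).1 (hsnoc _ ▸ h (HenkinModel.mk hV (hW (idx φ.all v))))
      simpa [h₁] using hV _ (.henkin φ v)
    · intro h a
      obtain ⟨a, rfl⟩ := Quotient.exists_rep a
      refine (hsnoc a).symm ▸ (ih _).2 ?_
      simpa [h] using hV _ (.all φ v a)

end Henkin

/-! ### The valuation of a model -/

theorem idx_injective {k k' : ℕ} {φ : LA.BoundedFormula Empty k} {ψ : LA.BoundedFormula Empty k'}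
    {v : Fin k → ℕ} {w : Fin k' → ℕ} (h : idx φ v = idx ψ w) :
    (⟨k, φ, v⟩ : Σ k, LA.BoundedFormula Empty k × (Fin k → ℕ)) = ⟨k', ψ, w⟩ := by
  obtain ⟨h₁, h₂⟩ := Nat.pair_eq_pair.1 h
  cases code_injective (Encodable.encode_injective h₁)
  cases List.ofFn_inj'.1 (Encodable.encode_injective h₂)
  rfl

theorem le_encode_of_mem {l : List ℕ} {a : ℕ} (h : a ∈ l) : a ≤ Encodable.encode l := by
  induction l with
  | nil => cases h
  | cons b l ih =>
    rw [Encodable.encode_list_cons]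
    obtain rfl | h := List.mem_cons.1 h
    · exact (Nat.left_le_pair _ _).trans (Nat.le_succ _)
    · exact (ih h).trans ((Nat.right_le_pair _ _).trans (Nat.le_succ _))

theorem lt_hW_idx {k : ℕ} (φ : LA.BoundedFormula Empty k) (v : Fin k → ℕ) (i : Fin k) :
    v i < hW (idx φ v) := by
  have h₁ : v i ≤ Encodable.encode (List.ofFn v) := le_encode_of_mem (by simp)
  have h₂ : Encodable.encode (List.ofFn v) ≤ idx φ v := Nat.right_le_pair _ _
  unfold hW
  omega

section Valuation

variable (M : Type) [LA.Structure M] [Nonempty M]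

open Classical in
/-- An interpretation of the closed Henkin terms in a structure. -/
noncomputable def hEval : ℕ → M
  | 0 => Structure.funMap (L := LA) ArithFunc.zero ![]
  | m + 1 =>
    have : m / 4 < m + 1 := by omega
    have : (m / 4).unpair.1 < m + 1 := (Nat.unpair_left_le _).trans_lt this
    have : (m / 4).unpair.2 < m + 1 := (Nat.unpair_right_le _).trans_lt ‹m / 4 < m + 1›
    if m % 4 = 0 then Structure.funMap (L := LA) ArithFunc.succ ![hEval (m / 4)]
    else if m % 4 = 1 then Structure.funMap (L := LA) ArithFunc.add
      ![hEval (m / 4).unpair.1, hEval (m / 4).unpair.2]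
    else if m % 4 = 2 then Structure.funMap (L := LA) ArithFunc.mul
      ![hEval (m / 4).unpair.1, hEval (m / 4).unpair.2]
    else Classical.epsilon fun a => ∀ (k : ℕ) (φ : LA.BoundedFormula Empty (k + 1)) (v : Fin k → ℕ),
      m / 4 = idx φ.all v → ¬ Sat φ (Fin.snoc (fun i => if _ : v i < m + 1 then hEval (v i)
        else Classical.arbitrary M : Fin k → M) a : Fin (k + 1) → M)

theorem hEval_hS (a : ℕ) :
    hEval M (hS a) = Structure.funMap (L := LA) ArithFunc.succ ![hEval M a] := by
  rw [hS, hEval]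
  simp

theorem hEval_hA (a b : ℕ) :
    hEval M (hA a b) = Structure.funMap (L := LA) ArithFunc.add ![hEval M a, hEval M b] := by
  have h₁ : (4 * Nat.pair a b + 1) % 4 = 1 := by omega
  have h₂ : (4 * Nat.pair a b + 1) / 4 = Nat.pair a b := by omega
  rw [hA, hEval]
  simp [h₁, h₂]

theorem hEval_hM (a b : ℕ) :
    hEval M (hM a b) = Structure.funMap (L := LA) ArithFunc.mul ![hEval M a, hEval M b] := by
  have h₁ : (4 * Nat.pair a b + 2) % 4 = 2 := by omega
  have h₂ : (4 * Nat.pair a b + 2) / 4 = Nat.pair a b := by omega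
  rw [hM, hEval]
  simp [h₁, h₂]

theorem not_sat_hEval_hW {k : ℕ} {φ : LA.BoundedFormula Empty (k + 1)} {v : Fin k → ℕ}
    (h : ¬ Sat φ.all fun i => hEval M (v i)) :
    ¬ Sat φ fun i => hEval M ((Fin.snoc v (hW (idx φ.all v)) : Fin (k + 1) → ℕ) i) := by
  have hlt (i : Fin k) : v i < 4 * idx φ.all v + 3 + 1 := lt_hW_idx φ.all v i
  have h₁ : (4 * idx φ.all v + 3) % 4 = 3 := by omega
  have h₂ : (4 * idx φ.all v + 3) / 4 = idx φ.all v := by omega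
  obtain ⟨a, ha⟩ : ∃ a, ¬ Sat φ (Fin.snoc (fun i => hEval M (v i)) a : Fin (k + 1) → M) := by
    simpa [Sat] using h
  rw [show (fun i => hEval M ((Fin.snoc v (hW (idx φ.all v)) : Fin (k + 1) → ℕ) i)) =
    (Fin.snoc (fun i => hEval M (v i)) (hEval M (hW (idx φ.all v))) : Fin (k + 1) → M) from
    Fin.comp_snoc (hEval M) v _, hW, hEval, h₁, h₂]
  simp only [OfNat.ofNat_ne_zero, OfNat.ofNat_ne_one, Nat.reduceEqDiff, if_false]
  have key := Classical.epsilon_spec (p := fun a => ∀ (k' : ℕ)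
    (ψ : LA.BoundedFormula Empty (k' + 1)) (w : Fin k' → ℕ), idx φ.all v = idx ψ.all w →
      ¬ Sat ψ (Fin.snoc (fun i => if _ : w i < 4 * idx φ.all v + 3 + 1 then hEval M (w i)
        else Classical.arbitrary M : Fin k' → M) a : Fin (k' + 1) → M))
    ⟨a, fun k' ψ w h => by cases idx_injective h; simpa [hlt] using ha⟩ k φ v rfl
  simpa only [hlt, dite_true] using key

/-- The interpretation of closed Henkin terms as a homomorphism. -/
noncomputable def hEvalHom : Herb →[LA] M where
  toFun := hEval M
  map_fun' {n} f x := by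
    cases f with
    | zero =>
      change hEval M 0 = _
      rw [hEval]
      exact congrArg _ (funext fun i => i.elim0)
    | succ =>
      refine (hEval_hS M (x 0)).trans (congrArg _ (funext fun i => ?_))
      fin_cases i
      rfl
    | add =>
      refine (hEval_hA M (x 0) (x 1)).trans (congrArg _ (funext fun i => ?_))
      fin_cases i <;> rfl
    | mul =>
      refine (hEval_hM M (x 0) (x 1)).trans (congrArg _ (funext fun i => ?_))
      fin_cases i <;> rfl
  map_rel' r x h := h.elim

theorem val_hEval {k : ℕ} (v : Fin k → ℕ) (t : LA.Term (Empty ⊕ Fin k)) :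
    val (fun i => hEval M (v i)) t = hEval M (hval v t) := by
  refine Eq.trans ?_ (HomClass.realize_term (hEvalHom M) (t := t)
    (v := Sum.elim (default : Empty → Herb) v))
  refine congrArg (fun w => Term.realize w t) (funext fun i => ?_)
  obtain i | i := i
  · exact i.elim
  · rfl

open Classical in
/-- The valuation of a structure. -/
noncomputable def modelVal (i : ℕ) : Bool :=
  decide (∃ (k : ℕ) (φ : LA.BoundedFormula Empty k) (v : Fin k → ℕ),
    i = idx φ v ∧ Sat φ fun i => hEval M (v i))

theorem modelVal_idx {k : ℕ} (φ : LA.BoundedFormula Empty k) (v : Fin k → ℕ) (b : Bool) :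
    modelVal M (idx φ v) = b ↔ ((Sat φ fun i => hEval M (v i)) ↔ b = true) := by
  have h : modelVal M (idx φ v) = true ↔ Sat φ fun i => hEval M (v i) := by
    classical
    refine decide_eq_true_iff.trans ?_
    constructor
    · rintro ⟨k', ψ, w, h, hs⟩
      cases idx_injective h
      exact hs
    · exact fun h => ⟨k, φ, v, rfl, h⟩
  rw [← h]
  exact Bool.eq_iff_iff

theorem modelVal_eqAt (a b : ℕ) (s : Bool) :
    modelVal M (eqAt a b) = s ↔ (hEval M a = hEval M b ↔ s = true) :=
  modelVal_idx M _ _ s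

theorem modelVal_leAt (a b : ℕ) (s : Bool) :
    modelVal M (leAt a b) = s ↔ (Le (hEval M a) (hEval M b) ↔ s = true) := by
  rw [leAt, modelVal_idx, sat_leF]
  rfl

theorem modelVal_avoids {T : LA.Theory} (hT : ∀ φ ∈ T, Sat φ (default : Fin 0 → M)) :
    Avoids (Clause T) (modelVal M) := by
  intro c hc
  cases hc with
  | axm φ h =>
    have h₁ := hT φ h
    rw [Subsingleton.elim (default : Fin 0 → M) fun i => hEval M (![] i)] at h₁
    simpa [modelVal_idx] using h₁
  | falsum => simp [modelVal_idx, Sat, BoundedFormula.Realize]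
  | imp φ ψ v =>
    simp [modelVal_idx]
  | imp_left φ ψ v => simp [modelVal_idx]; tauto
  | imp_right φ ψ v => simp [modelVal_idx]
  | henkin φ v =>
    have := @not_sat_hEval_hW M _ _ _ φ v
    simp [modelVal_idx]
    tauto
  | all φ v a =>
    have hs : (fun i => hEval M ((Fin.snoc v a : Fin (_ + 1) → ℕ) i)) =
        Fin.snoc (fun i => hEval M (v i)) (hEval M a) := Fin.comp_snoc (hEval M) v a
    simp only [List.forall_mem_cons, modelVal_idx, hs]
    simpa [Sat] using fun h => h (hEval M a)
  | equal t s v b =>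
    simp [modelVal_idx, modelVal_eqAt, ← val_hEval]
    change (val _ t = val _ s ↔ _) → _
    cases b <;> simp
  | le t s v b =>
    simp [modelVal_idx, modelVal_leAt, ← val_hEval, sat_leF]
    cases b <;> simp
  | refl => simp [modelVal_eqAt]
  | euclid a b c => simp +contextual [modelVal_eqAt]
  | succ_congr a b => simp +contextual [modelVal_eqAt, hEval_hS]
  | add_congr a b => simp +contextual [modelVal_eqAt, hEval_hA]
  | mul_congr a b => simp +contextual [modelVal_eqAt, hEval_hM]
  | le_congr a b => simp +contextual [modelVal_eqAt, modelVal_leAt]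

end Valuation

/-! ### Numerals and provability -/

/-- The interpretation of a numeral in a structure. -/
def num (M : Type) [LA.Structure M] (m : ℕ) : M := (numeral m).realize (default : Empty → M)

theorem num_zero (M : Type) [LA.Structure M] :
    num M 0 = Structure.funMap (L := LA) ArithFunc.zero ![] :=
  congrArg _ (funext fun i => i.elim0)

theorem num_succ (M : Type) [LA.Structure M] (m : ℕ) :
    num M (m + 1) = Structure.funMap (L := LA) ArithFunc.succ ![num M m] := by
  refine congrArg _ (funext fun i => ?_)
  fin_cases i
  rfl

/-- A structure satisfies all sentences of a theory. -/
def IsModel (M : Type) [LA.Structure M] (T : LA.Theory) : Prop :=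
  ∀ φ ∈ T, Sat φ (default : Fin 0 → M)

theorem proves_iff {T : LA.Theory} {φ : LA.Sentence} : Proves T φ ↔
    ∀ (M : Type) [LA.Structure M] [Nonempty M], IsModel M T → Sat φ (default : Fin 0 → M) := by
  refine Theory.models_sentence_iff.trans ⟨fun h M _ _ hM => ?_, fun h M => ?_⟩
  · have : M ⊨ T := ⟨fun φ hφ => hM φ hφ⟩
    exact h (Theory.ModelType.of T M)
  · exact h M fun φ hφ => Theory.realize_sentence_of_mem T hφ

theorem mk_hNum {T : LA.Theory} {V : ℕ → Bool} (hV : Avoids (Clause T) V) (m : ℕ) :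
    HenkinModel.mk hV (hNum m) = num (HenkinModel hV) m := by
  induction m with
  | zero => exact (num_zero _).symm
  | succ m ih =>
    rw [num_succ, ← ih]
    rfl

theorem hEval_hNum (M : Type) [LA.Structure M] [Nonempty M] (m : ℕ) :
    hEval M (hNum m) = num M m := by
  induction m with
  | zero => rw [num_zero, hNum, hEval]
  | succ m ih => rw [num_succ, ← ih, hNum, hEval_hS]

/-- The completeness theorem for the clauses describing models of `T`. -/
theorem exists_avoids_clause_iff {T : LA.Theory} (ψ : LA.BoundedFormula Empty 1) (m : ℕ)
    (b : Bool) :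
    (∃ V, Avoids (Clause T) V ∧ V (idx ψ ![hNum m]) = b) ↔
      ∃ (M : Type) (_ : LA.Structure M) (_ : Nonempty M), IsModel M T ∧
        (Sat ψ ![num M m] ↔ b = true) := by
  constructor
  · rintro ⟨V, hV, hb⟩
    refine ⟨HenkinModel hV, inferInstance, ⟨.mk hV 0⟩, fun φ hφ => ?_, ?_⟩
    · have h := (HenkinModel.sat_iff hV φ ![]).2 (by simpa using hV _ (.axm φ hφ))
      rwa [Subsingleton.elim (default : Fin 0 → HenkinModel hV) _]
    · have h := HenkinModel.sat_iff hV ψ ![hNum m]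
      rw [hb, show (fun i => HenkinModel.mk hV (![hNum m] i)) = ![num _ m] from
        funext fun i => by fin_cases i; exact mk_hNum hV m] at h
      exact h
  · rintro ⟨M, _, _, hM, hb⟩
    refine ⟨modelVal M, modelVal_avoids M hM, (modelVal_idx M ψ _ b).2 ?_⟩
    rwa [show (fun i => hEval M (![hNum m] i)) = ![num _ m] from
        funext fun i => by fin_cases i; exact hEval_hNum M m]

/-- Decidability of `ψ(ψ̄)` in all models of a `Σ_{n+1}`-definable theory is `Σ_{n+1}`. -/
theorem exists_sgN_diag {n : ℕ} {T : LA.Theory} (hT : SgN n fun m => m ∈ axiomCodes T) (b : Bool) :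
    ∃ D : ℕ → Prop, SgN n D ∧ ∀ ψ : LA.BoundedFormula Empty 1, D (godel ψ) ↔
      ∀ (M : Type) [LA.Structure M] [Nonempty M], IsModel M T →
        (Sat ψ ![num M (godel ψ)] ↔ b = true) := by
  have h : Primrec fun m => (Nat.pair m (Encodable.encode [hNum m]), !b) :=
    (Primrec₂.natPair.comp .id (Primrec.encode.comp
      (Primrec.list_cons.comp primrec_hNum (.const [])))).pair (.const _)
  refine ⟨_, ((sg_not_exists_avoids (sg_clause hT)).comp h).sgN, fun ψ => ?_⟩
  have hi : Nat.pair (godel ψ) (Encodable.encode [hNum (godel ψ)]) = idx ψ ![hNum (godel ψ)] := by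
    rw [← encode_code]
    rfl
  dsimp only
  rw [hi, exists_avoids_clause_iff]
  push Not
  cases b <;> simp

/-! ### Standard elements of models of Robinson arithmetic -/

section Robinson

variable {M : Type} [LA.Structure M]

/-- The interpretation of the successor. -/
def sc (a : M) : M := Structure.funMap (L := LA) ArithFunc.succ ![a]

/-- The interpretation of addition. -/
def ad (a b : M) : M := Structure.funMap (L := LA) ArithFunc.add ![a, b]

/-- The interpretation of multiplication. -/
def mu (a b : M) : M := Structure.funMap (L := LA) ArithFunc.mul ![a, b]

theorem num_succ_eq_sc (m : ℕ) : num M (m + 1) = sc (num M m) := num_succ M m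

/-- The axioms of Robinson arithmetic in terms of the interpretations of the symbols. -/
structure IsRobinson (M : Type) [LA.Structure M] : Prop where
  sc_ne_zero : ∀ a : M, sc a ≠ num M 0
  sc_inj : ∀ a b : M, sc a = sc b → a = b
  eq_sc : ∀ a : M, a ≠ num M 0 → ∃ b, a = sc b
  ad_zero : ∀ a : M, ad a (num M 0) = a
  ad_sc : ∀ a b : M, ad a (sc b) = sc (ad a b)
  mu_zero : ∀ a : M, mu a (num M 0) = num M 0
  mu_sc : ∀ a b : M, mu a (sc b) = ad (mu a b) a
  le_iff : ∀ a b : M, Le a b ↔ ∃ c, ad c a = b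

theorem val_zeroT {k : ℕ} (v : Fin k → M) : val v zeroT = num M 0 :=
  congrArg _ (funext fun i => i.elim0)

theorem val_succT {k : ℕ} (v : Fin k → M) (t : LA.Term (Empty ⊕ Fin k)) :
    val v (succT t) = sc (val v t) := by
  refine congrArg _ (funext fun i => ?_)
  fin_cases i
  rfl

theorem val_addT {k : ℕ} (v : Fin k → M) (t s : LA.Term (Empty ⊕ Fin k)) :
    val v (addT t s) = ad (val v t) (val v s) := by
  refine congrArg _ (funext fun i => ?_)
  fin_cases i <;> rfl

theorem val_mulT {k : ℕ} (v : Fin k → M) (t s : LA.Term (Empty ⊕ Fin k)) :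
    val v (mulT t s) = mu (val v t) (val v s) := by
  refine congrArg _ (funext fun i => ?_)
  fin_cases i <;> rfl

theorem IsModel.isRobinson (h : IsModel M QTheory) : IsRobinson M := by
  simp only [IsModel, QTheory, Set.mem_insert_iff, Set.mem_singleton_iff, forall_eq_or_imp,
    forall_eq] at h
  obtain ⟨h₁, h₂, h₃, h₄, h₅, h₆, h₇, h₈⟩ := h
  refine ⟨fun a => ?_, fun a b => ?_, fun a => ?_, fun a => ?_, fun a b => ?_, fun a => ?_,
    fun a b => ?_, fun a b => ?_⟩
  · have h : ¬ (val _ _ = val _ _) := h₁ a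
    rwa [val_succT, val_zeroT] at h
  · have h : val _ _ = val _ _ → val _ _ = val _ _ := h₂ a b
    rwa [val_succT, val_succT] at h
  · have h : ¬ (val _ _ = val _ _) → _ := h₃ a
    rw [val_zeroT] at h
    intro ha
    obtain ⟨b, hb⟩ := realize_ex.1 (h ha)
    exact ⟨b, Eq.trans hb (val_succT _ _)⟩
  · have h : val _ _ = val _ _ := h₄ a
    rwa [val_addT, val_zeroT] at h
  · have h : val _ _ = val _ _ := h₅ a b
    rwa [val_addT, val_succT, val_succT, val_addT] at h
  · have h : val _ _ = val _ _ := h₆ a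
    rwa [val_mulT, val_zeroT] at h
  · have h : val _ _ = val _ _ := h₇ a b
    rwa [val_mulT, val_succT, val_addT, val_mulT] at h
  · have h := realize_iff.1 (realize_alls.1 h₈ ![a, b])
    rw [realize_ex] at h
    refine (sat_leF _ _ _).symm.trans (h.trans (exists_congr fun c => ?_))
    refine (sat_equal _ _ _).trans ?_
    rw [val_addT]
    rfl

end Robinson

namespace IsRobinson

variable {M : Type} [LA.Structure M]

theorem ad_num (hM : IsRobinson M) (a b : ℕ) : ad (num M a) (num M b) = num M (a + b) := by
  induction b with
  | zero => exact hM.ad_zero _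
  | succ b ih => rw [num_succ_eq_sc, hM.ad_sc, ih, ← num_succ_eq_sc, Nat.add_assoc]

theorem mu_num (hM : IsRobinson M) (a b : ℕ) : mu (num M a) (num M b) = num M (a * b) := by
  induction b with
  | zero => exact hM.mu_zero _
  | succ b ih => rw [num_succ_eq_sc, hM.mu_sc, ih, hM.ad_num, Nat.mul_succ]

theorem exists_of_le_num (hM : IsRobinson M) {m : ℕ} {a : M} (h : Le a (num M m)) :
    ∃ x ≤ m, a = num M x := by
  induction m generalizing a with
  | zero =>
    refine ⟨0, le_rfl, by_contra fun ha => ?_⟩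
    obtain ⟨c, hc⟩ := (hM.le_iff _ _).1 h
    obtain ⟨b, rfl⟩ := hM.eq_sc a ha
    exact hM.sc_ne_zero _ ((hM.ad_sc c b).symm.trans hc)
  | succ m ih =>
    by_cases ha : a = num M 0
    · exact ⟨0, Nat.zero_le _, ha⟩
    · obtain ⟨c, hc⟩ := (hM.le_iff _ _).1 h
      obtain ⟨b, rfl⟩ := hM.eq_sc a ha
      rw [num_succ_eq_sc, hM.ad_sc] at hc
      obtain ⟨x, hx, rfl⟩ := ih ((hM.le_iff _ _).2 ⟨c, hM.sc_inj _ _ hc⟩)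
      exact ⟨x + 1, by omega, (num_succ_eq_sc x).symm⟩

theorem le_num_or_num_le (hM : IsRobinson M) (m : ℕ) (a : M) : Le a (num M m) ∨ Le (num M m) a := by
  induction m generalizing a with
  | zero => exact .inr ((hM.le_iff _ _).2 ⟨a, hM.ad_zero a⟩)
  | succ m ih =>
    by_cases ha : a = num M 0
    · exact .inl ((hM.le_iff _ _).2 ⟨num M (m + 1), by rw [ha, hM.ad_zero]⟩)
    · obtain ⟨b, rfl⟩ := hM.eq_sc a ha
      simp only [hM.le_iff, num_succ_eq_sc, hM.ad_sc] at ih ⊢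
      exact (ih b).imp (fun ⟨c, hc⟩ => ⟨c, congrArg sc hc⟩) fun ⟨c, hc⟩ => ⟨c, congrArg sc hc⟩

theorem val_num (hM : IsRobinson M) {k : ℕ} (v : Fin k → ℕ) (t : LA.Term (Empty ⊕ Fin k)) :
    val (fun i => num M (v i)) t = num M (val v t) := by
  have hfun {n : ℕ} (f : LA.Functions n) (x : Fin n → ℕ) :
      num M (Structure.funMap f x) = Structure.funMap f fun i => num M (x i) := by
    cases f with
    | zero => exact (num_zero M).trans (congrArg _ (funext fun i => i.elim0))
    | succ =>
      refine (num_succ M (x 0)).trans (congrArg _ (funext fun i => ?_))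
      fin_cases i
      rfl
    | add =>
      refine (hM.ad_num (x 0) (x 1)).symm.trans (congrArg _ (funext fun i => ?_))
      fin_cases i <;> rfl
    | mul =>
      refine (hM.mu_num (x 0) (x 1)).symm.trans (congrArg _ (funext fun i => ?_))
      fin_cases i <;> rfl
  induction t with
  | var i =>
    obtain i | i := i
    · exact i.elim
    · rfl
  | func f ts ih =>
    refine Eq.trans ?_ (hfun f _).symm
    exact congrArg _ (funext ih)

end IsRobinson

/-! ### Transfer of true sentences -/

/-- The numeral of `m` as a term in a context. -/
def numT {k : ℕ} (m : ℕ) : LA.Term (Empty ⊕ Fin k) := (numeral m).relabel Sum.inl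

theorem val_numT {M : Type} [LA.Structure M] {k : ℕ} (v : Fin k → M) (m : ℕ) :
    val v (numT m) = num M m := by
  rw [val, numT, Term.realize_relabel]
  rfl

theorem num_nat (m : ℕ) : num ℕ m = m := by
  induction m with
  | zero => exact num_zero ℕ
  | succ m ih => exact (num_succ ℕ m).trans (congrArg Nat.succ ih)

theorem map_snoc {α β : Type} (f : α → β) {k : ℕ} (v : Fin k → α) (a : α) :
    (fun i => f ((Fin.snoc v a : Fin (k + 1) → α) i)) = Fin.snoc (fun i => f (v i)) (f a) :=
  Fin.comp_snoc f v a

section Transfer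

variable {n : ℕ} {M : Type} [LA.Structure M]

theorem IsPi.transfer (hM : IsModel M (PiTh n)) {k : ℕ} {φ : LA.BoundedFormula Empty k}
    (h : IsPi n φ) {v : Fin k → ℕ} (hv : Sat φ v) : Sat φ fun i => num M (v i) := by
  have h₁ : Sat (GRNonRE.bsub φ fun i => numT (v i)) (default : Fin 0 → M) := by
    have h₀ : Sat (GRNonRE.bsub φ fun i => numT (v i)) (default : Fin 0 → ℕ) := by
      rw [sat_bsub]
      simpa only [val_numT, num_nat] using hv
    refine hM _ ⟨h.bsub _, ?_⟩
    unfold Sentence.Realize Formula.Realize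
    convert h₀
  rw [sat_bsub] at h₁
  simpa only [val_numT] using h₁

theorem IsSigma.transfer (hR : IsRobinson M) (hM : IsModel M (PiTh n)) {k : ℕ}
    {φ : LA.BoundedFormula Empty k} : IsSigma (n + 1) φ → ∀ {v : Fin k → ℕ}, Sat φ v →
      Sat φ fun i => num M (v i)
  | .ofPi h, v, hv => h.transfer hM hv
  | .ex h, v, hv => by
    obtain ⟨a, ha⟩ := realize_ex.1 hv
    refine realize_ex.2 ⟨num M a, ?_⟩
    rw [← map_snoc (num M) v a]
    exact transfer hR hM h ha
  | .inf h h', v, hv =>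
    realize_inf.2 ((realize_inf.1 hv).imp (transfer hR hM h) (transfer hR hM h'))
  | .sup h h', v, hv =>
    realize_sup.2 ((realize_sup.1 hv).imp (transfer hR hM h) (transfer hR hM h'))
  | .bdall t h, v, hv => by
    rw [sat_bdall] at hv ⊢
    intro a ha
    rw [hR.val_num] at ha
    obtain ⟨x, hx, rfl⟩ := hR.exists_of_le_num ha
    rw [← map_snoc (num M) v x]
    exact transfer hR hM h (hv x hx)

theorem IsPi.transfer_iff (hR : IsRobinson M) (hM : IsModel M (PiTh n)) {k : ℕ}
    {φ : LA.BoundedFormula Empty k} (h : IsPi n φ) (v : Fin k → ℕ) :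
    (Sat φ fun i => num M (v i)) ↔ Sat φ v := by
  refine ⟨fun hv => by_contra fun hv' => ?_, h.transfer hM⟩
  obtain ⟨ψ, hψ, hd⟩ := h.exists_dual
  exact (hd M _).1 (hψ.succ.transfer hR hM ((hd ℕ v).2 hv')) hv

end Transfer

/-! ### Normal form of `Σ_{n+1}`-formulas -/

/-- `R` is definable in `ℕ` by a `Πₙ`-formula. -/
def PiR (n : ℕ) {k : ℕ} (R : (Fin k → ℕ) → Prop) : Prop :=
  ∃ φ : LA.BoundedFormula Empty k, IsPi n φ ∧ ∀ v, Sat φ v ↔ R v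

namespace PiR

variable {n k k' : ℕ} {R S : (Fin k → ℕ) → Prop}

theorem and (h : PiR n R) (h' : PiR n S) : PiR n fun v => R v ∧ S v := by
  obtain ⟨φ, hφ, e⟩ := h
  obtain ⟨ψ, hψ, e'⟩ := h'
  refine ⟨φ ⊓ ψ, ?_, fun v => by simp only [Sat, realize_inf, ← e, ← e']⟩
  cases n with
  | zero =>
    cases hφ with | ofDelta0 hφ =>
    cases hψ with | ofDelta0 hψ =>
    exact .ofDelta0 (.imp (.imp hφ (.imp hψ .falsum)) .falsum)
  | succ n => exact .inf hφ hψ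

theorem or (h : PiR n R) (h' : PiR n S) : PiR n fun v => R v ∨ S v := by
  obtain ⟨φ, hφ, e⟩ := h
  obtain ⟨ψ, hψ, e'⟩ := h'
  refine ⟨φ ⊔ ψ, ?_, fun v => by simp only [Sat, realize_sup, ← e, ← e']⟩
  cases n with
  | zero =>
    cases hφ with | ofDelta0 hφ =>
    cases hψ with | ofDelta0 hψ =>
    exact .ofDelta0 (.imp (.imp hφ .falsum) hψ)
  | succ n => exact .sup hφ hψ

theorem rename (h : PiR n R) (σ : Fin k → Fin k') :
    PiR n fun v : Fin k' → ℕ => R fun i => v (σ i) :=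
  let ⟨_, hφ, e⟩ := h
  ⟨_, hφ.bsub fun i => &(σ i), fun v => by rw [sat_bsub, e]; rfl⟩

theorem bex {R : (Fin (k + 1) → ℕ) → Prop} (h : PiR n R) (t : LA.Term (Empty ⊕ Fin k)) :
    PiR n fun v : Fin k → ℕ => ∃ a ≤ val v t, R (Fin.snoc v a) := by
  obtain ⟨φ, hφ, e⟩ := h
  cases n with
  | zero =>
    cases hφ with | ofDelta0 hφ =>
    refine ⟨_, .ofDelta0 (.imp (.bdall t (.imp hφ .falsum)) .falsum), fun v => ?_⟩
    refine (not_congr (sat_bdall t φ.not v)).trans ?_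
    simp only [Sat, realize_not] at e ⊢
    simp only [e, le_nat]
    push Not
    rfl
  | succ n => exact ⟨_, .bdex t hφ, fun v => by simp only [sat_bdex, e, le_nat]⟩

theorem ball {R : (Fin (k + 1) → ℕ) → Prop} (h : PiR n R) (t : LA.Term (Empty ⊕ Fin k)) :
    PiR n fun v : Fin k → ℕ => ∀ a ≤ val v t, R (Fin.snoc v a) := by
  obtain ⟨φ, hφ, e⟩ := h
  cases n with
  | zero =>
    cases hφ with | ofDelta0 hφ =>
    exact ⟨_, .ofDelta0 (.bdall t hφ), fun v => by simp only [sat_bdall, e, le_nat]⟩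
  | succ n =>
    refine ⟨((leF (&(Fin.last k)) (liftT t)).not ⊔ φ).all,
      .all (.sup (Delta0.isSigma_and_isPi (.imp (.le _ _) .falsum) _).2 hφ), fun v => ?_⟩
    have h := sat_bdall t φ v
    simp only [e, le_nat] at h
    refine Iff.trans ?_ h
    simp only [Sat, realize_all, realize_sup, realize_not, realize_imp, imp_iff_not_or]

end PiR

/-- Exchange of the last two variables. -/
def swapLast (k : ℕ) : Fin (k + 2) → Fin (k + 2) :=
  Fin.snoc (Fin.snoc (fun i : Fin k => i.castSucc.castSucc) (Fin.last (k + 1)) :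
    Fin (k + 1) → Fin (k + 2)) (Fin.last k).castSucc

theorem snoc_snoc_swapLast {k : ℕ} (v : Fin k → ℕ) (x a : ℕ) :
    (fun i => (Fin.snoc (Fin.snoc v x : Fin (k + 1) → ℕ) a : Fin (k + 2) → ℕ) (swapLast k i)) =
      Fin.snoc (Fin.snoc v a : Fin (k + 1) → ℕ) x := by
  unfold swapLast
  rw [map_snoc, map_snoc]
  simp

/-- A `Σ_{n+1}`-formula is equivalent in `ℕ` to `∃ x` followed by a monotone `Πₙ`-formula. -/
theorem IsSigma.exists_normal_form {n : ℕ} : ∀ {k : ℕ} {φ : LA.BoundedFormula Empty k},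
    IsSigma (n + 1) φ → ∃ R : (Fin (k + 1) → ℕ) → Prop, PiR n R ∧
      (∀ v : Fin k → ℕ, Monotone fun x : ℕ => R (Fin.snoc v x)) ∧
      ∀ v, Sat φ v ↔ ∃ x : ℕ, R (Fin.snoc v x)
  | k, φ, .ofPi h =>
    ⟨_, PiR.rename ⟨φ, h, fun _ => Iff.rfl⟩ Fin.castSucc, fun v x y _ h => by simpa using h,
      fun v => by simp⟩
  | k, _, .inf h h' => by
    obtain ⟨R, hR, hm, e⟩ := h.exists_normal_form
    obtain ⟨R', hR', hm', e'⟩ := h'.exists_normal_form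
    refine ⟨_, hR.and hR', fun v x y hxy h => h.imp (hm v hxy) (hm' v hxy), fun v => ?_⟩
    simp only [Sat] at e e'
    simp only [Sat, realize_inf, e, e']
    constructor
    · rintro ⟨⟨x, hx⟩, ⟨y, hy⟩⟩
      exact ⟨max x y, hm v (le_max_left x y) hx, hm' v (le_max_right x y) hy⟩
    · rintro ⟨x, hx, hy⟩
      exact ⟨⟨x, hx⟩, ⟨x, hy⟩⟩
  | k, _, .sup h h' => by
    obtain ⟨R, hR, hm, e⟩ := h.exists_normal_form
    obtain ⟨R', hR', hm', e'⟩ := h'.exists_normal_form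
    refine ⟨_, hR.or hR', fun v x y hxy h => h.imp (hm v hxy) (hm' v hxy), fun v => ?_⟩
    simp only [Sat] at e e'
    simp only [Sat, realize_sup, e, e', exists_or]
  | k, _, .ex h => by
    obtain ⟨R, hR, hm, e⟩ := h.exists_normal_form
    refine ⟨_, (hR.rename (swapLast k)).bex (&(Fin.last k)), fun v x y hxy h => ?_, fun v => ?_⟩
    · simp only [snoc_snoc_swapLast, val_last] at h ⊢
      exact h.imp fun a ⟨ha, h⟩ => ⟨ha.trans hxy, hm _ hxy h⟩
    · simp only [Sat] at e
      simp only [snoc_snoc_swapLast, val_last, Sat, realize_ex, e]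
      constructor
      · rintro ⟨a, x, h⟩
        exact ⟨max a x, a, le_max_left a x, hm _ (le_max_right a x) h⟩
      · rintro ⟨x, a, _, h⟩
        exact ⟨a, x, h⟩
  | k, _, .bdall t h => by
    obtain ⟨R, hR, hm, e⟩ := h.exists_normal_form
    refine ⟨_, (hR.rename (swapLast k)).ball (liftT t), fun v x y hxy h => ?_, fun v => ?_⟩
    · simp only [snoc_snoc_swapLast, val_liftT] at h ⊢
      exact fun a ha => hm _ hxy (h a ha)
    · simp only [snoc_snoc_swapLast, val_liftT, sat_bdall, e, le_nat]
      constructor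
      · intro h
        choose! f hf using h
        exact ⟨(Finset.range (val v t + 1)).sup f, fun a ha =>
          hm _ (Finset.le_sup (f := f) (Finset.mem_range.2 (Nat.lt_succ_of_le ha))) (hf a ha)⟩
      · rintro ⟨x, h⟩ a ha
        exact ⟨x, h a ha⟩

theorem SgN.exists_normal_form {n : ℕ} {P : ℕ → Prop} (h : SgN n P) :
    ∃ d : LA.BoundedFormula Empty 2, IsPi n d ∧ ∀ m, P m ↔ ∃ x, Sat d ![m, x] := by
  obtain ⟨φ, hφ, e⟩ := h
  obtain ⟨R, ⟨d, hd, e₁⟩, -, e₂⟩ := hφ.exists_normal_form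
  refine ⟨d, hd, fun m => ?_⟩
  refine (e ![m]).symm.trans ((e₂ _).trans (exists_congr fun x => ?_))
  rw [← e₁, show (Fin.snoc ![m] x : Fin 2 → ℕ) = ![m, x] from
    funext fun i => by fin_cases i <;> rfl]

/-- The Rosser formula `∀ x₁ (¬ d(x₀, x₁) ∨ ∃ x₂ ≤ x₁, d'(x₀, x₂))`, where `c` expresses `¬ d`. -/
def rosser (c d' : LA.BoundedFormula Empty 2) : LA.BoundedFormula Empty 1 :=
  (c ⊔ (leF (&(Fin.last 2)) (liftT (&1)) ⊓ bsub d' ![&0, &2]).ex).all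

theorem sat_rosser {M : Type} [LA.Structure M] {c d d' : LA.BoundedFormula Empty 2}
    (hc : IsDual d c) (a : M) : Sat (rosser c d') ![a] ↔
      ∀ x : M, Sat d ![a, x] → ∃ y, Le y x ∧ Sat d' ![a, y] := by
  refine realize_all.trans (forall_congr' fun x => realize_sup.trans ?_)
  have h₁ : (Fin.snoc ![a] x : Fin 2 → M) = ![a, x] := funext fun i => by fin_cases i <;> rfl
  rw [h₁, imp_iff_not_or]
  refine or_congr (hc M _) ((sat_bdex _ _ _).trans (exists_congr fun y => and_congr Iff.rfl ?_))
  rw [sat_bsub]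
  refine iff_of_eq (congrArg _ (funext fun i => ?_))
  fin_cases i <;> rfl

/-- **Rosser's theorem** for `Σ_{n+1}`-definable theories consistent with `Πₙ-Th(ℕ)`. -/
theorem exists_undecided {n : ℕ} {T : LA.Theory} (hQ : ExtendsQ T)
    (hdef : SgN n fun m => m ∈ axiomCodes T) (hcon : Consistent (T ∪ PiTh n)) :
    ∃ γ : LA.Sentence, IsPi (n + 1) γ ∧ ¬ Proves T γ ∧ ¬ Proves T (∼γ) := by
  obtain ⟨M, _, _, hM⟩ : ∃ (M : Type) (_ : LA.Structure M) (_ : Nonempty M),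
      IsModel M (T ∪ PiTh n) := by
    by_contra h
    exact hcon (proves_iff.2 fun M _ _ hM => h ⟨M, _, ‹_›, hM⟩)
  have hT : IsModel M T := fun φ hφ => hM φ (.inl hφ)
  have hP : IsModel M (PiTh n) := fun φ hφ => hM φ (.inr hφ)
  have hR : IsRobinson M := IsModel.isRobinson fun φ hφ => proves_iff.1 (hQ φ hφ) M hT
  obtain ⟨D, hD, eD⟩ := exists_sgN_diag hdef true
  obtain ⟨D', hD', eD'⟩ := exists_sgN_diag hdef false
  obtain ⟨d, hd, ed⟩ := hD.exists_normal_form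
  obtain ⟨d', hd', ed'⟩ := hD'.exists_normal_form
  obtain ⟨c, hc, hdc⟩ := hd.exists_dual
  have transfer {e : LA.BoundedFormula Empty 2} (he : IsPi n e) (a b : ℕ) :
      Sat e ![num M a, num M b] ↔ Sat e ![a, b] := by
    refine Iff.trans ?_ (he.transfer_iff hR hP ![a, b])
    refine iff_of_eq (congrArg _ (funext fun i => ?_))
    fin_cases i <;> rfl
  let θ := rosser c d'
  let m := godel θ
  have hγ {N : Type} [LA.Structure N] :
      Sat (bsub θ fun _ => numT m : LA.Sentence) (default : Fin 0 → N) ↔ Sat θ ![num N m] := by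
    rw [sat_bsub]
    refine iff_of_eq (congrArg _ (funext fun i => ?_))
    fin_cases i
    exact val_numT _ m
  have hDm : Proves T (bsub θ fun _ => numT m) ↔ D m := by
    simp only [proves_iff, hγ]
    exact (eD θ).trans (by simp; rfl) |>.symm
  have hDm' : Proves T (∼(bsub θ fun _ => numT m : LA.Sentence)) ↔ D' m := by
    simp only [proves_iff, Sat, realize_not]
    simp only [hγ]
    exact (eD' θ).trans (by simp; rfl) |>.symm
  have hθ := sat_rosser (d' := d') hdc (num M m)
  refine ⟨bsub θ fun _ => numT m, IsPi.bsub (.all (.sup (.ofSigma hc)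
    (.bdex (&1) ((hd'.succ).bsub _)))) _, fun h => ?_, fun h => ?_⟩
  · obtain ⟨x, hx⟩ := (ed m).1 (hDm.1 h)
    obtain ⟨y, hy, hy'⟩ := hθ.1 (hγ.1 (proves_iff.1 h M hT)) _ ((transfer hd m x).2 hx)
    obtain ⟨y, -, rfl⟩ := hR.exists_of_le_num hy
    have h' := hDm'.2 ((ed' m).2 ⟨y, (transfer hd' m y).1 hy'⟩)
    exact proves_iff.1 h' M hT (proves_iff.1 h M hT)
  · obtain ⟨y, hy⟩ := (ed' m).1 (hDm'.1 h)
    have hn := proves_iff.1 h M hT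
    refine hn (hγ.2 (hθ.2 fun x hx => ?_))
    obtain hle | hle := hR.le_num_or_num_le y x
    · obtain ⟨x, -, rfl⟩ := hR.exists_of_le_num hle
      have h' := hDm.2 ((ed m).2 ⟨x, (transfer hd m x).1 hx⟩)
      exact (hn (proves_iff.1 h' M hT)).elim
    · exact ⟨_, hle, (transfer hd' m y).2 hy⟩

theorem SigmaDefinable.sgN {n : ℕ} {A : Set ℕ} (h : SigmaDefinable (n + 1) A) :
    SgN n fun m => m ∈ A := by
  obtain ⟨Ψ, hΨ, hA⟩ := h
  refine ⟨Ψ, hΨ, fun v => ((hA (v 0)).trans ?_).symm⟩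
  rw [show ![v 0] = v from funext fun i => by fin_cases i; rfl]
  exact iff_of_eq (congrArg (Ψ.Realize · v) (Subsingleton.elim _ _))

/-- **Corollary 2.9.** No `Σₙ`-definable (`n ≥ 1`) extension of `Q` that is
consistent with `Π_{n-1}-Th(ℕ)` is `Πₙ`-deciding. -/
theorem sigmaDefinable_consistentWithPiPredTh_not_piDeciding (n : ℕ) (hn : 1 ≤ n)
    (T : LA.Theory) (hQ : ExtendsQ T)
    (hdef : SigmaDefinable n (axiomCodes T))
    (hcon : Consistent (T ∪ PiTh (n - 1))) :
    ∃ γ : LA.Sentence, IsPi n γ ∧ ¬ Proves T γ ∧ ¬ Proves T (∼γ) := by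
  obtain ⟨n, rfl⟩ := Nat.exists_eq_add_of_le' hn
  exact exists_undecided hQ hdef.sgN hcon

end GRNonRE
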